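/- There exists a constant c_A ≥ 1, depending only on ξ, A, B, such that the following holds. Let f satisfy condition (f), let d ≥ 1, let p be the d-th partial sum of the Fourier series of f, and let r = f − p. Then for almost all x ∈ [A,B]: limsup_{N→∞} |Σ_{n=1}^N r(ξ x^{s_n})| / √(N log log N) ≤ 238 c_A d^{-1/8}. -/

import Mathlib

open MeasureTheory Filter

/-- The natural logarithm, interpreted as `max {1, log x}`. -/
noncomputable def plog (x : ℝ) : ℝ := max 1 (Real.log x)

/-- Fourier cosine coefficient of a 1-periodic function. -/
noncomputable def fourierA (f : ℝ → ℝ) (j : ℕ) : ℝ :=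
  2 * ∫ x in (0:ℝ)..1, f x * Real.cos (2 * Real.pi * j * x)

/-- Fourier sine coefficient of a 1-periodic function. -/
noncomputable def fourierB (f : ℝ → ℝ) (j : ℕ) : ℝ :=
  2 * ∫ x in (0:ℝ)..1, f x * Real.sin (2 * Real.pi * j * x)

/-- The `d`-th partial sum of the Fourier series of `f`. -/
noncomputable def fourierPartial (f : ℝ → ℝ) (d : ℕ) (x : ℝ) : ℝ :=
  ∑ j ∈ Finset.Icc 1 d,
    (fourierA f j * Real.cos (2 * Real.pi * j * x) +
     fourierB f j * Real.sin (2 * Real.pi * j * x))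


lemma cover_principle (φ : ℝ → ℝ) (a b : ℝ) (hab : a ≤ b) (hc : ContinuousOn φ (Set.Icc a b))
    (P : ℝ → ℝ → Prop)
    (concat : ∀ u v w, a ≤ u → u ≤ v → v ≤ w → w ≤ b → P u v → P v w → P u w)
    (unit : ∀ u v, a ≤ u → u ≤ v → v ≤ b → 1 ≤ φ v - φ u → φ v - φ u ≤ 2 → P u v)
    (h1 : 1 ≤ φ b - φ a) : P a b := by
  have key : ∀ n : ℕ, ∀ u, a ≤ u → u ≤ b → 1 ≤ φ b - φ u → φ b - φ u ≤ n + 1 → P u b := by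
    intro n
    induction n with
    | zero =>
      intro u h1 h2 h3 h4
      exact unit u b h1 h2 le_rfl h3 (by push_cast at h4; linarith)
    | succ n ih =>
      intro u hu h2 h3 h4
      by_cases h5 : φ b - φ u ≤ 2
      · exact unit u b hu h2 le_rfl h3 h5
      · rw [not_le] at h5
        have : φ u + 1 ∈ φ '' Set.Icc u b := by
          apply intermediate_value_Icc h2 (hc.mono (Set.Icc_subset_Icc hu le_rfl))
          constructor <;> linarith
        obtain ⟨c, ⟨hc1, hc2⟩, hc3⟩ := this
        refine concat u c b hu hc1 hc2 le_rfl ?_ ?_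
        · exact unit u c hu hc1 hc2 (by linarith) (by linarith)
        · refine ih c (hu.trans hc1) hc2 (by linarith) ?_
          push_cast at h4
          linarith
  obtain ⟨n, hn⟩ := exists_nat_ge (φ b - φ a)
  exact key n a le_rfl hab h1 (by linarith)

lemma bdd_intervalIntegrable {F : ℝ → ℝ} {u v M : ℝ} (huv : u ≤ v) (hF : Measurable F)
    (hM : ∀ x, u ≤ x → x ≤ v → |F x| ≤ M) : IntervalIntegrable F volume u v := by
  rw [intervalIntegrable_iff_integrableOn_Icc_of_le huv]
  refine Measure.integrableOn_of_bounded (M := M) (by simp) hF.aestronglyMeasurable ?_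
  filter_upwards [ae_restrict_mem measurableSet_Icc] with x hx
  exact hM x hx.1 hx.2

lemma abs_integral_le_const {F : ℝ → ℝ} {u v M : ℝ} (huv : u ≤ v)
    (hM : ∀ x, u ≤ x → x ≤ v → |F x| ≤ M) : |∫ x in u..v, F x| ≤ M * (v - u) := by
  have := intervalIntegral.norm_integral_le_of_norm_le_const (f := F) (a := u) (b := v) (C := M) ?_
  · rwa [Real.norm_eq_abs, abs_of_nonneg (sub_nonneg.2 huv)] at this
  · intro x hx
    rw [Set.uIoc_of_le huv] at hx
    exact hM x hx.1.le hx.2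

lemma bv_ibp {G T k : ℝ → ℝ} {u v ω M : ℝ} (huv : u ≤ v)
    (hG : Measurable G) (hk : Measurable k)
    (hT : ∀ x y, u ≤ x → x ≤ y → y ≤ v → |G y - G x| ≤ T y - T x)
    (hM : ∀ x, u ≤ x → x ≤ v → |k x| ≤ M)
    (hω : ∀ x y, u ≤ x → x ≤ y → y ≤ v → |∫ t in x..y, k t| ≤ ω) :
    |∫ t in u..v, G t * k t| ≤ ω * (|G u| + (T v - T u)) := by
  have hM0 : 0 ≤ M := (abs_nonneg _).trans (hM u le_rfl huv)
  have hω0 : 0 ≤ ω := (abs_nonneg _).trans (hω u u le_rfl le_rfl huv)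
  have hT0 : ∀ x y, u ≤ x → x ≤ y → y ≤ v → 0 ≤ T y - T x := fun x y h1 h2 h3 =>
    (abs_nonneg _).trans (hT x y h1 h2 h3)
  have hGb : ∀ x, u ≤ x → x ≤ v → |G x| ≤ |G u| + (T v - T u) := by
    intro x h1 h2
    have a1 := hT u x le_rfl h1 h2
    have a2 := hT0 x v h1 h2 le_rfl
    have a3 : |G x| ≤ |G x - G u| + |G u| := by
      have := abs_add_le (G x - G u) (G u); simpa using this
    linarith
  have ik : ∀ x y, u ≤ x → x ≤ y → y ≤ v → IntervalIntegrable k volume x y := by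
    intro x y h1 h2 h3
    exact bdd_intervalIntegrable h2 hk (fun t ht1 ht2 => hM t (h1.trans ht1) (ht2.trans h3))
  have iGk : ∀ x y, u ≤ x → x ≤ y → y ≤ v → IntervalIntegrable (fun t => G t * k t) volume x y := by
    intro x y h1 h2 h3
    refine bdd_intervalIntegrable (M := (|G u| + (T v - T u)) * M) h2 (hG.mul hk) (fun t ht1 ht2 => ?_)
    rw [abs_mul]
    have b1 := hGb t (h1.trans ht1) (ht2.trans h3)
    have b2 := hM t (h1.trans ht1) (ht2.trans h3)
    gcongr
    exact (abs_nonneg _).trans b1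
  rcases eq_or_lt_of_le huv with h | huv'
  · subst h
    simp only [intervalIntegral.integral_same, abs_zero, sub_self, add_zero]
    have := abs_nonneg (G u)
    positivity
  set W : ℝ → ℝ := fun x => ∫ t in x..v, k t with hW
  have main : ∀ δ : ℝ, 0 < δ → δ ≤ v - u →
      |(∫ t in u..v, G t * k t) - G u * W u + G v * W v| ≤ (ω + 2 * M * δ) * (T v - T u) := by
    intro δ hδ hδ2
    refine cover_principle (fun x => x / δ) u v huv (by fun_prop)
      (fun x y => |(∫ t in x..y, G t * k t) - G x * W x + G y * W y| ≤ (ω + 2 * M * δ) * (T y - T x))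
      ?_ ?_ ?_
    · intro x y z h1 h2 h3 h4 p1 p2
      have e : (∫ t in x..z, G t * k t) = (∫ t in x..y, G t * k t) + ∫ t in y..z, G t * k t :=
        (intervalIntegral.integral_add_adjacent_intervals (iGk x y h1 h2 (h3.trans h4))
          (iGk y z (h1.trans h2) h3 h4)).symm
      rw [e]
      have := abs_add_le ((∫ t in x..y, G t * k t) - G x * W x + G y * W y)
        ((∫ t in y..z, G t * k t) - G y * W y + G z * W z)
      calc _ = |((∫ t in x..y, G t * k t) - G x * W x + G y * W y) +
        ((∫ t in y..z, G t * k t) - G y * W y + G z * W z)| := by congr 1; ring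
        _ ≤ _ := this
        _ ≤ _ := by linarith
    · intro x y h1 h2 h3 h4 h5
      have hd : y - x ≤ 2 * δ := by
        rw [← sub_div, div_le_iff₀ hδ] at h5; exact h5
      have e1 : W x = (∫ t in x..y, k t) + W y :=
        (intervalIntegral.integral_add_adjacent_intervals (ik x y h1 h2 h3)
          (ik y v (h1.trans h2) h3 le_rfl)).symm
      have e2 : (∫ t in x..y, (G t - G x) * k t) = (∫ t in x..y, G t * k t) - G x * ∫ t in x..y, k t := by
        rw [← intervalIntegral.integral_const_mul, ← intervalIntegral.integral_sub (iGk x y h1 h2 h3)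
          ((ik x y h1 h2 h3).const_mul _)]
        congr 1; ext t; ring
      have e3 : (∫ t in x..y, G t * k t) - G x * W x + G y * W y
          = (∫ t in x..y, (G t - G x) * k t) + (G y - G x) * W y := by rw [e1, e2]; ring
      rw [e3]
      have b1 : |∫ t in x..y, (G t - G x) * k t| ≤ ((T y - T x) * M) * (y - x) := by
        refine abs_integral_le_const h2 (fun t ht1 ht2 => ?_)
        rw [abs_mul]
        have c1 := hT x t h1 ht1 (ht2.trans h3)
        have c2 := hT0 t y (h1.trans ht1) ht2 h3
        have c3 := hM t (h1.trans ht1) (ht2.trans h3)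
        have c4 : |G t - G x| ≤ T y - T x := by linarith
        exact mul_le_mul c4 c3 (abs_nonneg _) (hT0 x y h1 h2 h3)
      have b2 : |(G y - G x) * W y| ≤ (T y - T x) * ω := by
        rw [abs_mul]
        exact mul_le_mul (hT x y h1 h2 h3) (hω y v (h1.trans h2) h3 le_rfl) (abs_nonneg _)
          (hT0 x y h1 h2 h3)
      have b3 : ((T y - T x) * M) * (y - x) ≤ ((T y - T x) * M) * (2 * δ) :=
        mul_le_mul_of_nonneg_left hd (mul_nonneg (hT0 x y h1 h2 h3) hM0)
      refine (abs_add_le _ _).trans ?_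
      linarith
    · rw [← sub_div, le_div_iff₀ hδ]; linarith
  have hWv : W v = 0 := by simp [hW]
  have lim : |(∫ t in u..v, G t * k t) - G u * W u + G v * W v| ≤ ω * (T v - T u) := by
    have ht : Tendsto (fun δ : ℝ => (ω + 2 * M * δ) * (T v - T u)) (nhdsWithin 0 (Set.Ioi 0))
        (nhds ((ω + 2 * M * 0) * (T v - T u))) := by
      refine Tendsto.mono_left ?_ nhdsWithin_le_nhds
      exact Continuous.tendsto (by fun_prop) 0
    rw [mul_zero, add_zero] at ht
    refine ge_of_tendsto ht ?_
    filter_upwards [Ioo_mem_nhdsGT (sub_pos.2 huv')] with δ hδ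
    exact main δ hδ.1 hδ.2.le
  rw [hWv, mul_zero, add_zero] at lim
  have c : |G u * W u| ≤ |G u| * ω := by
    rw [abs_mul]; exact mul_le_mul_of_nonneg_left (hω u v le_rfl huv le_rfl) (abs_nonneg _)
  have := abs_add_le ((∫ t in u..v, G t * k t) - G u * W u) (G u * W u)
  rw [sub_add_cancel] at this
  linarith


structure Ph (A B : ℝ) (p0 : ℕ) (φ D : ℕ → ℝ → ℝ) : Prop where
  hA : 1 < A
  hAB : A ≤ B
  der : ∀ n x, HasDerivAt (φ n) (D n x) x
  cont : ∀ n, Continuous (D n)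
  pos : ∀ n, p0 ≤ n → ∀ x, A ≤ x → x ≤ B → 0 < D n x
  mono : ∀ n, p0 ≤ n → ∀ x y, A ≤ x → x ≤ y → y ≤ B → D n x ≤ D n y
  ratio : ∀ m n, p0 ≤ m → m ≤ n → ∀ x, A ≤ x → x ≤ B → A ^ (n - m) * D m x ≤ D n x
  comp : ∀ n, p0 ≤ n → ∀ u v, A ≤ u → u ≤ v → v ≤ B → φ n v - φ n u ≤ 2 → D n v ≤ 3 * D n u
  full : ∀ n, p0 ≤ n → 1 ≤ φ n B - φ n A

structure Rh (r T : ℝ → ℝ) (V M β : ℝ) : Prop where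
  meas : Measurable r
  per : Function.Periodic r 1
  mean : ∫ x in (0:ℝ)..1, r x = 0
  ctrl : ∀ x y, x ≤ y → |r y - r x| ≤ T y - T x
  var : ∀ x y, x ≤ y → y ≤ x + 2 → T y - T x ≤ V
  bdd : ∀ x, |r x| ≤ M
  sq : ∫ x in (0:ℝ)..1, r x ^ 2 ≤ β

namespace Rh
variable {r T : ℝ → ℝ} {V M β : ℝ}

lemma M0 (h : Rh r T V M β) : 0 ≤ M := (abs_nonneg _).trans (h.bdd 0)
lemma V0 (h : Rh r T V M β) : 0 ≤ V :=
  ((abs_nonneg _).trans (h.ctrl 0 0 le_rfl)).trans (h.var 0 0 le_rfl (by norm_num))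
lemma b0 (h : Rh r T V M β) : 0 ≤ β :=
  le_trans (intervalIntegral.integral_nonneg (by norm_num) (fun x _ => sq_nonneg _)) h.sq

lemma ii (h : Rh r T V M β) (a b : ℝ) : IntervalIntegrable r volume a b := by
  rcases le_total a b with hab | hab
  · exact bdd_intervalIntegrable hab h.meas (fun x _ _ => h.bdd x)
  · exact (bdd_intervalIntegrable hab h.meas (fun x _ _ => h.bdd x)).symm

lemma iisq (h : Rh r T V M β) (a b : ℝ) : IntervalIntegrable (fun x => r x ^ 2) volume a b := by
  have : ∀ x, |r x ^ 2| ≤ M ^ 2 := fun x => by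
    rw [abs_pow]; exact pow_le_pow_left₀ (abs_nonneg _) (h.bdd x) 2
  rcases le_total a b with hab | hab
  · exact bdd_intervalIntegrable hab (h.meas.pow_const 2) (fun x _ _ => this x)
  · exact (bdd_intervalIntegrable hab (h.meas.pow_const 2) (fun x _ _ => this x)).symm

lemma l1 (h : Rh r T V M β) : ∫ x in (0:ℝ)..1, |r x| ≤ √β := by
  have hb := h.b0
  set I := ∫ x in (0:ℝ)..1, |r x| with hI
  have i1 : IntervalIntegrable (fun x => |r x|) volume 0 1 := (h.ii 0 1).abs
  have : 0 ≤ ∫ x in (0:ℝ)..1, (|r x| - I) ^ 2 :=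
    intervalIntegral.integral_nonneg (by norm_num) (fun x _ => sq_nonneg _)
  have e : ∫ x in (0:ℝ)..1, (|r x| - I) ^ 2 = (∫ x in (0:ℝ)..1, r x ^ 2) - I ^ 2 := by
    have : ∀ x, (|r x| - I) ^ 2 = r x ^ 2 - 2 * I * |r x| + I ^ 2 := fun x => by
      rw [← sq_abs (r x)]; ring
    simp_rw [this]
    rw [intervalIntegral.integral_add ((h.iisq 0 1).sub (i1.const_mul _)) (by simp),
      intervalIntegral.integral_sub (h.iisq 0 1) (i1.const_mul _),
      intervalIntegral.integral_const_mul, ← hI]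
    simp; ring
  apply Real.le_sqrt_of_sq_le
  have := h.sq
  linarith

lemma prim (h : Rh r T V M β) (a b : ℝ) (hab : a ≤ b) : |∫ x in a..b, r x| ≤ √β := by
  -- remove whole periods
  obtain ⟨n, hn⟩ : ∃ n : ℤ, n ≤ b - a ∧ b - a < n + 1 := ⟨⌊b - a⌋, Int.floor_le _, Int.lt_floor_add_one _⟩
  have e : ∫ x in a..(a + n • (1:ℝ)), r x = 0 := by
    rw [h.per.intervalIntegral_add_zsmul_eq n a (fun a b => h.ii a b), h.per.intervalIntegral_add_eq a 0,
      zero_add, h.mean]; simp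
  have e2 : ∫ x in a..b, r x = ∫ x in (a + n • (1:ℝ))..b, r x := by
    rw [← intervalIntegral.integral_add_adjacent_intervals (h.ii a (a + n • (1:ℝ))) (h.ii _ b), e, zero_add]
  rw [e2]
  set c := a + n • (1:ℝ) with hc
  have hc1 : c ≤ b := by rw [hc]; simp; linarith
  have hc2 : b ≤ c + 1 := by rw [hc]; simp; linarith
  calc |∫ x in c..b, r x| ≤ ∫ x in c..b, |r x| := intervalIntegral.abs_integral_le_integral_abs hc1
    _ ≤ ∫ x in c..(c+1), |r x| := by
      apply intervalIntegral.integral_mono_interval le_rfl hc1 hc2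
      · exact Eventually.of_forall fun x => abs_nonneg _
      · exact (h.ii _ _).abs
    _ = ∫ x in (0:ℝ)..(0+1), |r x| := by
      have : Function.Periodic (fun x => |r x|) 1 := fun x => by simp only [h.per x]
      exact this.intervalIntegral_add_eq _ _
    _ ≤ √β := by rw [zero_add]; exact h.l1

lemma sq2 (h : Rh r T V M β) (a b : ℝ) (hab : a ≤ b) (hb : b ≤ a + 2) :
    ∫ x in a..b, r x ^ 2 ≤ 2 * β := by
  have hp : Function.Periodic (fun x => r x ^ 2) 1 := fun x => by simp only [h.per x]
  calc ∫ x in a..b, r x ^ 2 ≤ ∫ x in a..(a + 2), r x ^ 2 := by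
        apply intervalIntegral.integral_mono_interval le_rfl hab hb
        · exact Eventually.of_forall fun x => sq_nonneg _
        · exact h.iisq _ _
    _ = (∫ x in a..(a+1), r x ^ 2) + ∫ x in (a+1)..(a+1+1), r x ^ 2 := by
        rw [intervalIntegral.integral_add_adjacent_intervals (h.iisq _ _) (h.iisq _ _)]
        congr 1; ring
    _ ≤ 2 * β := by
        rw [hp.intervalIntegral_add_eq a 0, hp.intervalIntegral_add_eq (a+1) 0, zero_add]
        have := h.sq; linarith

end Rh

namespace Ph
variable {A B : ℝ} {p0 : ℕ} {φ D : ℕ → ℝ → ℝ}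

lemma contφ (h : Ph A B p0 φ D) (n : ℕ) : Continuous (φ n) :=
  continuous_iff_continuousAt.2 fun x => (h.der n x).continuousAt

lemma inc (h : Ph A B p0 φ D) {n : ℕ} (hn : p0 ≤ n) {u v : ℝ} (hu : A ≤ u) (huv : u ≤ v) (hv : v ≤ B) :
    D n u * (v - u) ≤ φ n v - φ n u ∧ φ n v - φ n u ≤ D n v * (v - u) := by
  rcases eq_or_lt_of_le huv with e | e
  · subst e; simp
  · obtain ⟨c, hc, hc2⟩ := exists_hasDerivAt_eq_slope (φ n) (D n) e (h.contφ n).continuousOn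
      (fun x _ => h.der n x)
    rw [eq_div_iff (by linarith)] at hc2
    rw [← hc2]
    constructor
    · exact mul_le_mul_of_nonneg_right (h.mono n hn u c hu hc.1.le (hc.2.le.trans hv)) (by linarith)
    · exact mul_le_mul_of_nonneg_right (h.mono n hn c v (hu.trans hc.1.le) hc.2.le hv) (by linarith)

lemma D_le (h : Ph A B p0 φ D) {m n : ℕ} (hm : p0 ≤ m) (hmn : m ≤ n) {x : ℝ} (hx : A ≤ x) (hx2 : x ≤ B) :
    D m x ≤ D n x := by
  have := h.ratio m n hm hmn x hx hx2
  have h2 : 1 ≤ A ^ (n - m) := one_le_pow₀ h.hA.le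
  have h3 := h.pos m hm x hx hx2
  nlinarith

lemma inc_mono (h : Ph A B p0 φ D) {m n : ℕ} (hm : p0 ≤ m) (hmn : m ≤ n) {u v : ℝ} (hu : A ≤ u)
    (huv : u ≤ v) (hv : v ≤ B) : φ m v - φ m u ≤ φ n v - φ n u := by
  rcases eq_or_lt_of_le huv with e | e
  · subst e; simp
  · obtain ⟨c, hc, hc2⟩ := exists_hasDerivAt_eq_slope (fun x => φ n x - φ m x) (fun x => D n x - D m x) e
      ((h.contφ n).sub (h.contφ m)).continuousOn (fun x _ => (h.der n x).sub (h.der m x))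
    rw [eq_div_iff (by linarith)] at hc2
    have := h.D_le hm hmn (hu.trans hc.1.le) (hc.2.le.trans hv)
    nlinarith

lemma inc_nonneg (h : Ph A B p0 φ D) {n : ℕ} (hn : p0 ≤ n) {u v : ℝ} (hu : A ≤ u) (huv : u ≤ v) (hv : v ≤ B) :
    0 ≤ φ n v - φ n u :=
  le_trans (mul_nonneg (h.pos n hn u hu (huv.trans hv)).le (by linarith)) (h.inc hn hu huv hv).1

lemma unit_low (h : Ph A B p0 φ D) {n : ℕ} (hn : p0 ≤ n) {u v : ℝ} (hu : A ≤ u) (huv : u ≤ v) (hv : v ≤ B)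
    (h1 : 1 ≤ φ n v - φ n u) (h2 : φ n v - φ n u ≤ 2) : 1 / D n u ≤ 3 * (v - u) := by
  have a := (h.inc hn hu huv hv).2
  have b := h.comp n hn u v hu huv hv h2
  have c := h.pos n hn u hu (huv.trans hv)
  rw [div_le_iff₀ c]
  nlinarith

lemma unit_up (h : Ph A B p0 φ D) {n : ℕ} (hn : p0 ≤ n) {u v : ℝ} (hu : A ≤ u) (huv : u ≤ v) (hv : v ≤ B)
    (h2 : φ n v - φ n u ≤ 2) : v - u ≤ 2 / D n u := by
  have a := (h.inc hn hu huv hv).1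
  have c := h.pos n hn u hu (huv.trans hv)
  rw [le_div_iff₀ c]
  linarith

lemma subst (h : Ph A B p0 φ D) {n : ℕ} (hn : p0 ≤ n) {u v : ℝ} (hu : A ≤ u) (huv : u ≤ v) (hv : v ≤ B)
    (g : ℝ → ℝ) : ∫ t in u..v, g (φ n t) * D n t = ∫ y in (φ n u)..(φ n v), g y := by
  have := intervalIntegral.integral_comp_mul_deriv_of_deriv_nonneg (f := φ n) (f' := D n) (g := g)
    (a := u) (b := v) (h.contφ n).continuousOn (fun x _ => h.der n x) ?_
  · exact this
  · intro x hx
    rw [min_eq_left huv, max_eq_right huv] at hx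
    exact (h.pos n hn x (hu.trans hx.1.le) (hx.2.le.trans hv)).le

end Ph

section est
variable {A B : ℝ} {p0 : ℕ} {φ D : ℕ → ℝ → ℝ} {r T : ℝ → ℝ} {V M β : ℝ}

lemma meas_rφ (h : Ph A B p0 φ D) (hr : Rh r T V M β) (n : ℕ) : Measurable (fun x => r (φ n x)) :=
  hr.meas.comp (h.contφ n).measurable

lemma est1 (h : Ph A B p0 φ D) (hr : Rh r T V M β) {n : ℕ} (hn : p0 ≤ n) {x y : ℝ} (hx : A ≤ x)
    (hxy : x ≤ y) (hy : y ≤ B) : |∫ t in x..y, r (φ n t)| ≤ 2 * √β / D n x := by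
  have key := bv_ibp (G := fun t => 1 / D n t) (T := fun t => - (1 / D n t))
    (k := fun t => r (φ n t) * D n t) (u := x) (v := y) (ω := √β) (M := M * D n y) hxy
    (by have := (h.cont n).measurable; fun_prop) ((meas_rφ h hr n).mul (h.cont n).measurable) ?_ ?_ ?_
  · have e : ∫ t in x..y, 1 / D n t * (r (φ n t) * D n t) = ∫ t in x..y, r (φ n t) := by
      apply intervalIntegral.integral_congr
      intro t ht
      rw [Set.uIcc_of_le hxy] at ht
      have := (h.pos n hn t (hx.trans ht.1) (ht.2.trans hy)).ne'
      simp only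
      field_simp
    rw [e] at key
    refine key.trans ?_
    have px := h.pos n hn x hx (hxy.trans hy)
    have py := h.pos n hn y (hx.trans hxy) hy
    rw [abs_of_pos (by positivity)]
    have : 0 < 1 / D n y := by positivity
    have s := Real.sqrt_nonneg β
    calc √β * (1 / D n x + (-(1 / D n y) - -(1 / D n x))) ≤ √β * (2 * (1 / D n x)) := by
          apply mul_le_mul_of_nonneg_left _ s; linarith
      _ = _ := by ring
  · intro a b h1 h2 h3
    have pa := h.pos n hn a (hx.trans h1) (h2.trans (h3.trans hy))
    have := one_div_le_one_div_of_le pa (h.mono n hn a b (hx.trans h1) h2 (h3.trans hy))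
    rw [abs_sub_comm, abs_of_nonneg (by linarith)]
    linarith
  · intro t h1 h2
    rw [abs_mul]
    have p := h.pos n hn t (hx.trans h1) (h2.trans hy)
    rw [abs_of_pos p]
    exact mul_le_mul (hr.bdd _) (h.mono n hn t y (hx.trans h1) h2 hy) p.le hr.M0
  · intro a b h1 h2 h3
    rw [h.subst hn (hx.trans h1) h2 (h3.trans hy)]
    apply hr.prim
    linarith [h.inc_nonneg hn (hx.trans h1) h2 (h3.trans hy)]

lemma ii_rφ2 (h : Ph A B p0 φ D) (hr : Rh r T V M β) (m n : ℕ) {u v : ℝ} (huv : u ≤ v) :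
    IntervalIntegrable (fun t => r (φ m t) * r (φ n t)) volume u v := by
  refine bdd_intervalIntegrable (M := M * M) huv ((meas_rφ h hr m).mul (meas_rφ h hr n)) (fun x _ _ => ?_)
  rw [abs_mul]
  exact mul_le_mul (hr.bdd _) (hr.bdd _) (abs_nonneg _) hr.M0

lemma est2 (h : Ph A B p0 φ D) (hr : Rh r T V M β) {n : ℕ} (hn : p0 ≤ n) {u v : ℝ} (hu : A ≤ u)
    (huv : u ≤ v) (hv : v ≤ B) (h1 : 1 ≤ φ n v - φ n u) :
    ∫ t in u..v, r (φ n t) * r (φ n t) ≤ 6 * β * (v - u) := by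
  refine cover_principle (φ n) u v huv (h.contφ n).continuousOn
    (fun a b => ∫ t in a..b, r (φ n t) * r (φ n t) ≤ 6 * β * (b - a)) ?_ ?_ h1
  · intro a b c _ hab hbc _ p1 p2
    rw [← intervalIntegral.integral_add_adjacent_intervals (ii_rφ2 h hr n n hab) (ii_rφ2 h hr n n hbc)]
    linarith
  · intro a b ha hab hb h1 h2
    have pa := h.pos n hn a (hu.trans ha) (hab.trans (hb.trans hv))
    have s1 : ∫ t in a..b, r (φ n t) * r (φ n t) ≤ ∫ t in a..b, (1 / D n a) * (r (φ n t) ^ 2 * D n t) := by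
      apply intervalIntegral.integral_mono_on hab (ii_rφ2 h hr n n hab)
      · refine bdd_intervalIntegrable (M := (1 / D n a) * (M ^ 2 * D n b)) hab ?_ ?_
        · exact (((meas_rφ h hr n).pow_const 2).mul (h.cont n).measurable).const_mul _
        · intro t ht1 ht2
          have p := h.pos n hn t (hu.trans (ha.trans ht1)) (ht2.trans (hb.trans hv))
          rw [abs_mul, abs_mul, abs_pow, abs_of_pos p, abs_of_pos (by positivity)]
          have q1 := hr.bdd (φ n t)
          have q2 := h.mono n hn t b (hu.trans (ha.trans ht1)) ht2 (hb.trans hv)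
          have := hr.M0
          gcongr
      · intro t ht
        have q2 := h.mono n hn a t (hu.trans ha) ht.1 (ht.2.trans (hb.trans hv))
        have : 1 ≤ (1 / D n a) * D n t := by rw [one_div_mul_eq_div, one_le_div pa]; exact q2
        nlinarith [sq_nonneg (r (φ n t))]
    rw [intervalIntegral.integral_const_mul, h.subst hn (hu.trans ha) hab (hb.trans hv) (fun y => r y ^ 2)] at s1
    have s2 := hr.sq2 (φ n a) (φ n b) (by linarith) (by linarith)
    have s3 := h.unit_low hn (hu.trans ha) hab (hb.trans hv) h1 h2
    have hb0 := hr.b0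
    have : 0 < 1 / D n a := by positivity
    calc _ ≤ _ := s1
      _ ≤ 1 / D n a * (2 * β) := by gcongr
      _ ≤ (3 * (b - a)) * (2 * β) := by gcongr
      _ = _ := by ring

lemma est3 (h : Ph A B p0 φ D) (hr : Rh r T V M β) {m n : ℕ} (hm : p0 ≤ m) (hmn : m ≤ n) {u v : ℝ}
    (hu : A ≤ u) (huv : u ≤ v) (hv : v ≤ B) (h1 : 1 ≤ φ m v - φ m u) :
    |∫ t in u..v, r (φ m t) * r (φ n t)| ≤ 6 * √β * (M + V) * (A ^ (n - m))⁻¹ * (v - u) := by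
  refine cover_principle (φ m) u v huv (h.contφ m).continuousOn
    (fun a b => |∫ t in a..b, r (φ m t) * r (φ n t)| ≤ 6 * √β * (M + V) * (A ^ (n - m))⁻¹ * (b - a)) ?_ ?_ h1
  · intro a b c _ hab hbc _ p1 p2
    rw [← intervalIntegral.integral_add_adjacent_intervals (ii_rφ2 h hr m n hab) (ii_rφ2 h hr m n hbc)]
    refine (abs_add_le _ _).trans ?_
    linarith
  · intro a b ha hab hb h1 h2
    have hn : p0 ≤ n := hm.trans hmn
    have haA := hu.trans ha
    have hbB := hb.trans hv
    have pa := h.pos n hn a haA (hab.trans hbB)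
    have pm := h.pos m hm a haA (hab.trans hbB)
    have key := bv_ibp (G := fun t => r (φ m t)) (T := fun t => T (φ m t)) (k := fun t => r (φ n t))
      (u := a) (v := b) (ω := 2 * √β / D n a) (M := M) hab (meas_rφ h hr m) (meas_rφ h hr n) ?_ ?_ ?_
    · have hV := hr.var (φ m a) (φ m b) (by linarith) (by linarith)
      have hM := hr.bdd (φ m a)
      have s3 := h.unit_low hm haA hab hbB h1 h2
      have ra := h.ratio m n hm hmn a haA (hab.trans hbB)
      have hAp : 0 < A ^ (n - m) := pow_pos (by linarith [h.hA]) _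
      have M0 := hr.M0
      have V0 := hr.V0
      have q : 1 / D n a ≤ (A ^ (n - m))⁻¹ * (3 * (b - a)) := by
        calc 1 / D n a ≤ 1 / (A ^ (n - m) * D m a) := by gcongr
          _ = (A ^ (n - m))⁻¹ * (1 / D m a) := by field_simp
          _ ≤ _ := by gcongr
      calc _ ≤ _ := key
        _ ≤ 2 * √β / D n a * (M + V) := by gcongr
        _ = 2 * √β * (M + V) * (1 / D n a) := by ring
        _ ≤ 2 * √β * (M + V) * ((A ^ (n - m))⁻¹ * (3 * (b - a))) := by gcongr
        _ = _ := by ring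
    · intro x y hx hxy hy
      apply hr.ctrl
      linarith [h.inc_nonneg hm (haA.trans hx) hxy (hy.trans hbB)]
    · intro x _ _; exact hr.bdd _
    · intro x y hx hxy hy
      refine (est1 h hr hn (haA.trans hx) hxy (hy.trans hbB)).trans ?_
      have := h.mono n hn a x haA hx (hxy.trans (hy.trans hbB))
      gcongr

lemma est3b (h : Ph A B p0 φ D) (hr : Rh r T V M β) {m n : ℕ} (hm : p0 ≤ m) (hmn : m ≤ n) {u v : ℝ}
    (hu : A ≤ u) (huv : u ≤ v) (hv : v ≤ B) (h1 : 1 ≤ φ m v - φ m u) :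
    |∫ t in u..v, r (φ m t) * r (φ n t)| ≤ 6 * β * (v - u) := by
  have e1 := est2 h hr hm hu huv hv h1
  have e2 := est2 h hr (hm.trans hmn) hu huv hv (h1.trans (h.inc_mono hm hmn hu huv hv))
  calc _ ≤ ∫ t in u..v, |r (φ m t) * r (φ n t)| := intervalIntegral.abs_integral_le_integral_abs huv
    _ ≤ ∫ t in u..v, (1/2) * (r (φ m t) * r (φ m t) + r (φ n t) * r (φ n t)) := by
      apply intervalIntegral.integral_mono_on huv (ii_rφ2 h hr m n huv).abs
      · exact ((ii_rφ2 h hr m m huv).add (ii_rφ2 h hr n n huv)).const_mul _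
      · intro t _
        rw [abs_le]
        constructor <;> nlinarith [sq_nonneg (r (φ m t) + r (φ n t)), sq_nonneg (r (φ m t) - r (φ n t))]
    _ ≤ _ := by
      rw [intervalIntegral.integral_const_mul,
        intervalIntegral.integral_add (ii_rφ2 h hr m m huv) (ii_rφ2 h hr n n huv)]
      linarith

lemma est4 (h : Ph A B p0 φ D) (hr : Rh r T V M β) {σ : ℝ} (hσ0 : 0 ≤ σ)
    (hσ : 36 * β * √β * (M + V) ≤ σ ^ 2) {m n : ℕ} (hm : p0 ≤ m) (hmn : m ≤ n) {u v : ℝ}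
    (hu : A ≤ u) (huv : u ≤ v) (hv : v ≤ B) (h1 : 1 ≤ φ m v - φ m u) :
    |∫ t in u..v, r (φ m t) * r (φ n t)| ≤ σ * (√A⁻¹) ^ (n - m) * (v - u) := by
  have a := est3 h hr hm hmn hu huv hv h1
  have b := est3b h hr hm hmn hu huv hv h1
  have hA := h.hA
  have hvu : 0 ≤ v - u := by linarith
  have hAp : 0 < A ^ (n - m) := pow_pos (by linarith) _
  set X := |∫ t in u..v, r (φ m t) * r (φ n t)|
  have hX : 0 ≤ X := abs_nonneg _
  refine (pow_le_pow_iff_left₀ hX (by positivity) two_ne_zero).1 ?_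
  have M0 := hr.M0
  have V0 := hr.V0
  have b0 := hr.b0
  calc X ^ 2 = X * X := by ring
    _ ≤ (6 * √β * (M + V) * (A ^ (n - m))⁻¹ * (v - u)) * (6 * β * (v - u)) :=
      mul_le_mul a b hX (by positivity)
    _ = (36 * β * √β * (M + V)) * (A ^ (n - m))⁻¹ * (v - u) ^ 2 := by ring
    _ ≤ σ ^ 2 * (A ^ (n - m))⁻¹ * (v - u) ^ 2 := by gcongr
    _ = (σ * (√A⁻¹) ^ (n - m) * (v - u)) ^ 2 := by
      rw [mul_pow, mul_pow, ← pow_mul, mul_comm (n - m) 2, pow_mul, Real.sq_sqrt (by positivity), inv_pow]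
end est


lemma geo_half {q : ℝ} (h0 : 0 ≤ q) (h1 : q < 1) (S : Finset ℕ) (e : ℕ → ℕ) (P : ℕ → Prop) [DecidablePred P]
    (he : ∀ x y, P x → P y → e x = e y → x = y) :
    ∑ n ∈ S, (if P n then q ^ (e n) else 0) ≤ 1 / (1 - q) := by
  rw [← Finset.sum_filter]
  have : ∑ n ∈ S.filter P, q ^ (e n) = ∑ i ∈ (S.filter P).image e, q ^ i := by
    rw [Finset.sum_image]
    intro x hx y hy hxy
    simp at hx hy
    exact he x y hx.2 hy.2 hxy
  rw [this, one_div, ← tsum_geometric_of_lt_one h0 h1]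
  exact (summable_geometric_of_lt_one h0 h1).sum_le_tsum _ (fun i _ => pow_nonneg h0 i)

lemma geo_sum {q : ℝ} (h0 : 0 ≤ q) (h1 : q < 1) (S : Finset ℕ) (m : ℕ) :
    ∑ n ∈ S, q ^ ((n - m) + (m - n)) ≤ 2 / (1 - q) := by
  calc ∑ n ∈ S, q ^ ((n - m) + (m - n))
      ≤ ∑ n ∈ S, ((if m ≤ n then q ^ (n - m) else 0) + (if n ≤ m then q ^ (m - n) else 0)) := by
        apply Finset.sum_le_sum
        intro n _
        rcases le_total m n with h | h
        · rw [if_pos h, Nat.sub_eq_zero_of_le h, add_zero]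
          have : 0 ≤ (if n ≤ m then q ^ 0 else 0) := by split_ifs <;> positivity
          linarith
        · rw [if_pos h, Nat.sub_eq_zero_of_le h, zero_add]
          have : 0 ≤ (if m ≤ n then q ^ 0 else 0) := by split_ifs <;> positivity
          linarith
    _ ≤ 1 / (1 - q) + 1 / (1 - q) := by
        rw [Finset.sum_add_distrib]
        apply add_le_add
        · exact geo_half h0 h1 S (fun n => n - m) (fun n => m ≤ n) (fun x y a b c => by omega)
        · exact geo_half h0 h1 S (fun n => m - n) (fun n => n ≤ m) (fun x y a b c => by omega)
    _ = 2 / (1 - q) := by ring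

section est
variable {A B : ℝ} {p0 : ℕ} {φ D : ℕ → ℝ → ℝ} {r T : ℝ → ℝ} {V M β : ℝ}

lemma block_sq (h : Ph A B p0 φ D) (hr : Rh r T V M β) {σ : ℝ} (hσ0 : 0 ≤ σ)
    (hσ : 36 * β * √β * (M + V) ≤ σ ^ 2) {p : ℕ} (hp : p0 ≤ p) (S : Finset ℕ) (hS : ∀ n ∈ S, p ≤ n)
    {u v : ℝ} (hu : A ≤ u) (huv : u ≤ v) (hv : v ≤ B) (h1 : 1 ≤ φ p v - φ p u) :
    ∫ t in u..v, (∑ n ∈ S, r (φ n t)) ^ 2 ≤ S.card * (2 * σ / (1 - √A⁻¹)) * (v - u) := by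
  have hA := h.hA
  have q0 : 0 ≤ √A⁻¹ := Real.sqrt_nonneg _
  have q1 : √A⁻¹ < 1 := by
    rw [Real.sqrt_lt' one_pos, one_pow]; exact inv_lt_one_of_one_lt₀ hA
  have e : ∀ t, (∑ n ∈ S, r (φ n t)) ^ 2 = ∑ m ∈ S, ∑ n ∈ S, r (φ m t) * r (φ n t) := by
    intro t; rw [sq, Finset.sum_mul_sum]
  simp_rw [e]
  rw [intervalIntegral.integral_finsetSum]
  · calc ∑ m ∈ S, ∫ t in u..v, ∑ n ∈ S, r (φ m t) * r (φ n t)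
        ≤ ∑ m ∈ S, (2 * σ / (1 - √A⁻¹)) * (v - u) := by
          apply Finset.sum_le_sum
          intro m hm
          rw [intervalIntegral.integral_finsetSum (fun n _ => ii_rφ2 h hr m n huv)]
          calc ∑ n ∈ S, ∫ t in u..v, r (φ m t) * r (φ n t)
              ≤ ∑ n ∈ S, σ * (√A⁻¹) ^ ((n - m) + (m - n)) * (v - u) := by
                apply Finset.sum_le_sum
                intro n hn
                have pm := hS m hm
                have pn := hS n hn
                have im := h1.trans (h.inc_mono hp pm hu huv hv)
                have in' := h1.trans (h.inc_mono hp pn hu huv hv)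
                rcases le_total m n with l | l
                · have := est4 h hr hσ0 hσ (hp.trans pm) l hu huv hv im
                  rw [Nat.sub_eq_zero_of_le l, add_zero]
                  exact (le_abs_self _).trans this
                · have := est4 h hr hσ0 hσ (hp.trans pn) l hu huv hv in'
                  rw [Nat.sub_eq_zero_of_le l, zero_add]
                  simp_rw [mul_comm (r (φ m _))]
                  exact (le_abs_self _).trans this
            _ = σ * (∑ n ∈ S, (√A⁻¹) ^ ((n - m) + (m - n))) * (v - u) := by
                rw [Finset.mul_sum, Finset.sum_mul]
            _ ≤ σ * (2 / (1 - √A⁻¹)) * (v - u) := by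
                have := geo_sum q0 q1 S m
                have : 0 ≤ v - u := by linarith
                gcongr
            _ = _ := by ring
      _ = _ := by rw [Finset.sum_const, nsmul_eq_mul]; ring
  · intro m _
    have := IntervalIntegrable.sum S (f := fun n x => r (φ m x) * r (φ n x)) (fun n _ => ii_rφ2 h hr m n huv)
    rwa [Finset.sum_fn] at this

lemma abs_block_le (hr : Rh r T V M β) (S : Finset ℕ) (x : ℝ) :
    |∑ n ∈ S, r (φ n x)| ≤ S.card * M := by
  refine (Finset.abs_sum_le_sum_abs _ _).trans ?_
  refine (Finset.sum_le_card_nsmul _ _ M (fun n _ => hr.bdd _)).trans ?_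
  rw [nsmul_eq_mul]

lemma meas_block (h : Ph A B p0 φ D) (hr : Rh r T V M β) (S : Finset ℕ) :
    Measurable (fun x => ∑ n ∈ S, r (φ n x)) :=
  Finset.measurable_fun_sum _ (fun n _ => meas_rφ h hr n)

lemma ii_of_bdd {F : ℝ → ℝ} {C : ℝ} (hF : Measurable F) (hb : ∀ x, |F x| ≤ C) (u v : ℝ) :
    IntervalIntegrable F volume u v := by
  rcases le_total u v with hab | hab
  · exact bdd_intervalIntegrable hab hF (fun x _ _ => hb x)
  · exact (bdd_intervalIntegrable hab hF (fun x _ _ => hb x)).symm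

lemma ii_exp {F : ℝ → ℝ} {C : ℝ} (hF : Measurable F) (hb : ∀ x, |F x| ≤ C) (l : ℝ) (hl : 0 ≤ l) (u v : ℝ) :
    IntervalIntegrable (fun x => Real.exp (l * F x)) volume u v := by
  refine ii_of_bdd (C := Real.exp (l * C)) (Real.measurable_exp.comp (hF.const_mul l)) (fun x => ?_) u v
  show |Real.exp (l * F x)| ≤ _
  rw [abs_of_pos (Real.exp_pos _)]
  gcongr
  exact (le_abs_self _).trans (hb x)

lemma exp_le_quad {x : ℝ} (hx : |x| ≤ 1) : Real.exp x ≤ 1 + x + x ^ 2 := by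
  have := Real.abs_exp_sub_one_sub_id_le hx
  have := (abs_le.1 this).2
  linarith

lemma block_exp (h : Ph A B p0 φ D) (hr : Rh r T V M β) {σ : ℝ} (hσ0 : 0 ≤ σ)
    (hσ : 36 * β * √β * (M + V) ≤ σ ^ 2) {p w : ℕ} (hp : p0 ≤ p) {l : ℝ} (hl : 0 ≤ l)
    (hlM : l * (2 * w * M) ≤ 1)
    {u v : ℝ} (hu : A ≤ u) (huv : u ≤ v) (hv : v ≤ B) (h1 : 1 ≤ φ p v - φ p u)
    (h2 : φ p v - φ p u ≤ 2) :
    ∫ t in u..v, Real.exp (l * ∑ n ∈ Finset.Ioc (p + w) (p + 3 * w), r (φ n t)) ≤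
      (1 + l * (2 * w) * (6 * √β * (A ^ w)⁻¹) + l ^ 2 * (2 * w * (2 * σ / (1 - √A⁻¹)))) * (v - u) := by
  set S := Finset.Ioc (p + w) (p + 3 * w) with hSdef
  have hS : ∀ n ∈ S, p + w ≤ n := fun n hn => (Finset.mem_Ioc.1 hn).1.le
  have hcard : (S.card : ℝ) = 2 * w := by
    rw [hSdef, Nat.card_Ioc]
    have : p + 3 * w - (p + w) = 2 * w := by omega
    rw [this]; push_cast; ring
  have hb : ∀ x, |∑ n ∈ S, r (φ n x)| ≤ 2 * w * M := fun x => by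
    rw [← hcard]; exact abs_block_le hr S x
  have hm := meas_block h hr S
  have sq := block_sq h hr hσ0 hσ hp S (fun n hn => (Nat.le_add_right p w).trans (hS n hn)) hu huv hv h1
  rw [hcard] at sq
  have lin : |∫ t in u..v, ∑ n ∈ S, r (φ n t)| ≤ (2 * w) * (6 * √β * (A ^ w)⁻¹) * (v - u) := by
    rw [intervalIntegral.integral_finsetSum (fun n _ => ii_of_bdd (meas_rφ h hr n) (fun x => hr.bdd _) u v)]
    refine (Finset.abs_sum_le_sum_abs _ _).trans ?_
    rw [← hcard, mul_assoc, ← nsmul_eq_mul]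
    refine Finset.sum_le_card_nsmul _ _ _ (fun n hn => ?_)
    have pn : p ≤ n := (Nat.le_add_right p w).trans (hS n hn)
    refine (est1 h hr (hp.trans pn) hu huv hv).trans ?_
    have pp := h.pos p hp u hu (huv.trans hv)
    have ra := h.ratio p n hp pn u hu (huv.trans hv)
    have low := h.unit_low hp hu huv hv h1 h2
    have hAw : 0 < A ^ w := pow_pos (by linarith [h.hA]) _
    have ra2 : A ^ w * D p u ≤ D n u := by
      refine le_trans ?_ ra
      have : A ^ w ≤ A ^ (n - p) := pow_le_pow_right₀ h.hA.le (by have := hS n hn; omega)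
      gcongr
    calc 2 * √β / D n u ≤ 2 * √β / (A ^ w * D p u) := by gcongr
      _ = 2 * √β * (A ^ w)⁻¹ * (1 / D p u) := by field_simp
      _ ≤ 2 * √β * (A ^ w)⁻¹ * (3 * (v - u)) := by gcongr
      _ = _ := by ring
  have i1 := ii_of_bdd hm hb u v
  have i2 : IntervalIntegrable (fun t => (∑ n ∈ S, r (φ n t)) ^ 2) volume u v :=
    ii_of_bdd (C := (2 * w * M) ^ 2) (hm.pow_const 2) (fun x => by
      rw [abs_pow]; exact pow_le_pow_left₀ (abs_nonneg _) (hb x) 2) u v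
  calc ∫ t in u..v, Real.exp (l * ∑ n ∈ S, r (φ n t))
      ≤ ∫ t in u..v, (1 + l * (∑ n ∈ S, r (φ n t)) + l ^ 2 * (∑ n ∈ S, r (φ n t)) ^ 2) := by
        apply intervalIntegral.integral_mono_on huv (ii_exp hm hb l hl u v)
        · exact ((intervalIntegrable_const).add (i1.const_mul _)).add (i2.const_mul _)
        · intro t _
          have : |l * ∑ n ∈ S, r (φ n t)| ≤ 1 := by
            rw [abs_mul, abs_of_nonneg hl]
            exact (mul_le_mul_of_nonneg_left (hb t) hl).trans hlM
          refine (exp_le_quad this).trans (le_of_eq (by ring))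
    _ = (v - u) + l * (∫ t in u..v, ∑ n ∈ S, r (φ n t)) + l ^ 2 * ∫ t in u..v, (∑ n ∈ S, r (φ n t)) ^ 2 := by
        rw [intervalIntegral.integral_add ((intervalIntegrable_const).add (i1.const_mul _)) (i2.const_mul _),
          intervalIntegral.integral_add (intervalIntegrable_const) (i1.const_mul _),
          intervalIntegral.integral_const_mul, intervalIntegral.integral_const_mul]
        simp
    _ ≤ (v - u) + l * ((2 * w) * (6 * √β * (A ^ w)⁻¹) * (v - u)) +
          l ^ 2 * ((2 * w) * (2 * σ / (1 - √A⁻¹)) * (v - u)) := by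
        have := (le_abs_self _).trans lin
        gcongr
    _ = _ := by ring

noncomputable def Esum (g : ℕ → ℝ → ℝ) (w : ℕ) : ℕ → ℕ → ℝ → ℝ
  | 0, _, _ => 0
  | m + 1, p, x => (∑ n ∈ Finset.Ioc (p + w) (p + 3 * w), g n x) + Esum g w m (p + 4 * w) x

lemma Esum_meas (h : Ph A B p0 φ D) (hr : Rh r T V M β) (w m : ℕ) : ∀ p,
    Measurable (Esum (fun n x => r (φ n x)) w m p) := by
  induction m with
  | zero => intro p; exact measurable_const
  | succ m ih => intro p; exact (meas_block h hr _).add (ih _)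

lemma Esum_bdd (hr : Rh r T V M β) (w m : ℕ) :
    ∃ C, ∀ p x, |Esum (fun n x => r (φ n x)) w m p x| ≤ C := by
  induction m with
  | zero => exact ⟨0, fun p x => by simp [Esum]⟩
  | succ m ih =>
    obtain ⟨C, hC⟩ := ih
    refine ⟨(2 * w : ℕ) * M + C, fun p x => ?_⟩
    refine (abs_add_le _ _).trans (add_le_add ?_ (hC _ _))
    refine (abs_block_le hr _ x).trans (le_of_eq ?_)
    rw [Nat.card_Ioc]; congr 2; omega

lemma exp_lip {x y : ℝ} (hx : x ≤ 1) : Real.exp x ≤ Real.exp y + 3 * |x - y| := by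
  rcases le_total x y with l | l
  · have := Real.exp_le_exp.2 l
    have := abs_nonneg (x - y)
    linarith
  · have h1 : Real.exp y = Real.exp x * Real.exp (y - x) := by rw [← Real.exp_add]; congr 1; ring
    have h2 := Real.add_one_le_exp (y - x)
    have h3 : Real.exp x ≤ 3 := by
      have := Real.exp_le_exp.2 hx
      have := Real.exp_one_lt_d9
      linarith
    rw [abs_of_nonneg (by linarith)]
    have h4 := Real.exp_pos x
    nlinarith

lemma main_step (h : Ph A B p0 φ D) (hr : Rh r T V M β) {σ : ℝ} (hσ0 : 0 ≤ σ)
    (hσ : 36 * β * √β * (M + V) ≤ σ ^ 2) {w : ℕ} {l : ℝ} (hl : 0 ≤ l)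
    (hlM : l * (2 * w * M) ≤ 1) (κ : ℝ)
    (hκ : κ = 1 + l * (2 * w) * ((6 * √β + 36 * V) * (A ^ w)⁻¹) + l ^ 2 * (2 * w * (2 * σ / (1 - √A⁻¹)))) (m : ℕ) :
    ∀ p, p0 ≤ p → ∀ u v, A ≤ u → u ≤ v → v ≤ B → 1 ≤ φ p v - φ p u → 
    ∫ t in u..v, Real.exp (l * Esum (fun n x => r (φ n x)) w m p t) ≤ κ ^ m * (v - u) := by
  have hA := h.hA
  have hAw : 0 < A ^ w := pow_pos (by linarith) _
  have q1 : √A⁻¹ < 1 := by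
    rw [Real.sqrt_lt' one_pos, one_pow]; exact inv_lt_one_of_one_lt₀ hA
  have q2 : 0 < 1 - √A⁻¹ := by linarith
  have V0 := hr.V0
  have M0 := hr.M0
  have hκ0 : 0 ≤ κ := by rw [hκ]; positivity
  induction m with
  | zero =>
    intro p _ u v _ _ _ _
    simp [Esum]
  | succ m ih =>
    intro p hp u v hu huv hv h1
    set F := Esum (fun n x => r (φ n x)) w (m + 1) p with hF
    obtain ⟨C, hC⟩ := Esum_bdd (φ := φ) hr w (m + 1)
    have iF : ∀ a b, IntervalIntegrable (fun t => Real.exp (l * F t)) volume a b :=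
      ii_exp (Esum_meas h hr w (m + 1) p) (hC p) l hl
    obtain ⟨C', hC'⟩ := Esum_bdd (φ := φ) hr w m
    set E' := Esum (fun n x => r (φ n x)) w m (p + 4 * w) with hE'
    have iE : ∀ a b, IntervalIntegrable (fun t => Real.exp (l * E' t)) volume a b :=
      ii_exp (Esum_meas h hr w m _) (hC' _) l hl
    -- reduce to unit intervals for φ p
    refine cover_principle (φ p) u v huv (h.contφ p).continuousOn
      (fun a b => ∫ t in a..b, Real.exp (l * F t) ≤ κ ^ (m + 1) * (b - a)) ?_ ?_ h1
    · intro a b c _ hab hbc _ p1 p2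
      rw [← intervalIntegral.integral_add_adjacent_intervals (iF a b) (iF b c)]
      linarith
    clear h1
    intro a b ha hab hb h1 h2
    replace ha := hu.trans ha
    replace hb := hb.trans hv
    clear hu huv hv
    set S := Finset.Ioc (p + w) (p + 3 * w) with hSdef
    set Y : ℝ → ℝ := fun t => ∑ n ∈ S, r (φ n t) with hY
    have hFY : ∀ t, F t = Y t + E' t := fun t => rfl
    have hcard : (S.card : ℝ) = 2 * w := by
      rw [hSdef, Nat.card_Ioc]
      have : p + 3 * w - (p + w) = 2 * w := by omega
      rw [this]; push_cast; ring
    have hYb : ∀ x, |Y x| ≤ 2 * w * M := fun x => by rw [← hcard]; exact abs_block_le hr S x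
    have iY : ∀ a b, IntervalIntegrable (fun t => Real.exp (l * Y t)) volume a b :=
      ii_exp (meas_block h hr S) hYb l hl
    have hlY : ∀ x, l * Y x ≤ 1 := fun x =>
      (mul_le_mul_of_nonneg_left ((le_abs_self _).trans (hYb x)) hl).trans hlM
    have hq : p0 ≤ p + 3 * w := hp.trans (Nat.le_add_right _ _)
    have hp' : p0 ≤ p + 4 * w := hp.trans (Nat.le_add_right _ _)
    have claimJ : ∫ t in a..b, Real.exp (l * F t) ≤
        κ ^ m * ((∫ t in a..b, Real.exp (l * Y t)) + l * (2 * w) * (36 * V * (A ^ w)⁻¹) * (b - a)) := by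
      refine cover_principle (φ (p + 3 * w)) a b hab (h.contφ _).continuousOn
        (fun a b => ∫ t in a..b, Real.exp (l * F t) ≤
        κ ^ m * ((∫ t in a..b, Real.exp (l * Y t)) + l * (2 * w) * (36 * V * (A ^ w)⁻¹) * (b - a))) ?_ ?_
        (h1.trans (h.inc_mono hp (Nat.le_add_right _ _) ha hab hb))
      · intro x y z _ hxy hyz _ p1 p2
        rw [← intervalIntegral.integral_add_adjacent_intervals (iF x y) (iF y z),
          ← intervalIntegral.integral_add_adjacent_intervals (iY x y) (iY y z)]
        linarith
      clear h1 h2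
      intro x y hx hxy hy h1 h2
      replace hx := ha.trans hx
      replace hy := hy.trans hb
      clear ha hab hb
      -- on Q = [x,y]
      set TY : ℝ → ℝ := fun t => ∑ n ∈ S, T (φ n t) with hTY
      have hS1 : ∀ n ∈ S, p0 ≤ n := fun n hn => by have := (Finset.mem_Ioc.1 hn).1; omega
      have hS2 : ∀ n ∈ S, n ≤ p + 3 * w := fun n hn => (Finset.mem_Ioc.1 hn).2
      have hctrl : ∀ c d, A ≤ c → c ≤ d → d ≤ B → |Y d - Y c| ≤ TY d - TY c := by
        intro c d h1 h2 h3
        rw [hY, hTY]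
        simp only
        rw [← Finset.sum_sub_distrib, ← Finset.sum_sub_distrib]
        refine (Finset.abs_sum_le_sum_abs _ _).trans (Finset.sum_le_sum fun n hn => ?_)
        apply hr.ctrl
        linarith [h.inc_nonneg (hS1 n hn) h1 h2 h3]
      have hvar : TY y - TY x ≤ 2 * w * V := by
        rw [hTY]
        simp only
        rw [← Finset.sum_sub_distrib, ← hcard, ← nsmul_eq_mul]
        refine Finset.sum_le_card_nsmul _ _ _ (fun n hn => ?_)
        apply hr.var
        · linarith [h.inc_nonneg (hS1 n hn) hx hxy hy]
        · linarith [h.inc_mono (hS1 n hn) (hS2 n hn) hx hxy hy]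
      have px := h.pos _ hp' x hx (hxy.trans hy)
      have claimQ : ∫ t in x..y, Real.exp (l * F t) ≤
          κ ^ m * ((∫ t in x..y, Real.exp (l * Y t)) + 12 * l / D (p + 4 * w) x * (TY y - TY x)) := by
        refine cover_principle (φ (p + 4 * w)) x y hxy (h.contφ _).continuousOn
          (fun x' y' => ∫ t in x'..y', Real.exp (l * F t) ≤
          κ ^ m * ((∫ t in x'..y', Real.exp (l * Y t)) + 12 * l / D (p + 4 * w) x * (TY y' - TY x'))) ?_ ?_
          (h1.trans (h.inc_mono hq (by omega) hx hxy hy))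
        · intro x y z _ hxy hyz _ p1 p2
          rw [← intervalIntegral.integral_add_adjacent_intervals (iF x y) (iF y z),
            ← intervalIntegral.integral_add_adjacent_intervals (iY x y) (iY y z)]
          linarith
        intro c d hc hcd hd h3 h4
        have hcA := hx.trans hc
        have hdB := hd.trans hy
        set δ := 3 * (l * (TY d - TY c)) with hδ
        have hδ0 : 0 ≤ δ := by
          have := (abs_nonneg _).trans (hctrl c d hcA hcd hdB)
          positivity
        have osc : ∀ t, c ≤ t → t ≤ d → |l * Y t - l * Y c| ≤ l * (TY d - TY c) := by
          intro t ht1 ht2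
          rw [← mul_sub, abs_mul, abs_of_nonneg hl]
          have a1 := hctrl c t hcA ht1 (ht2.trans hdB)
          have a2 := (abs_nonneg _).trans (hctrl t d (hcA.trans ht1) ht2 hdB)
          exact mul_le_mul_of_nonneg_left (by linarith) hl
        set s := Real.exp (l * Y c) with hs
        have up : ∀ t, c ≤ t → t ≤ d → Real.exp (l * Y t) ≤ s + δ := fun t ht1 ht2 => by
          have := exp_lip (y := l * Y c) (hlY t)
          have := osc t ht1 ht2
          linarith
        have dn : ∀ t, c ≤ t → t ≤ d → s ≤ Real.exp (l * Y t) + δ := fun t ht1 ht2 => by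
          have := exp_lip (y := l * Y t) (hlY c)
          have := osc t ht1 ht2
          rw [abs_sub_comm] at this
          linarith
        have dcl := h.unit_up hp' hcA hcd hdB h4
        have dcl2 : d - c ≤ 2 / D (p + 4 * w) x := by
          refine dcl.trans ?_
          have := h.mono _ hp' x c hx hc (hcd.trans hdB)
          gcongr
        have I1 : ∫ t in c..d, Real.exp (l * F t) ≤ (s + δ) * (κ ^ m * (d - c)) := by
          calc _ ≤ ∫ t in c..d, (s + δ) * Real.exp (l * E' t) := by
                apply intervalIntegral.integral_mono_on hcd (iF c d) ((iE c d).const_mul _)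
                intro t ht
                rw [hFY, mul_add, Real.exp_add]
                exact mul_le_mul_of_nonneg_right (up t ht.1 ht.2) (Real.exp_pos _).le
            _ = (s + δ) * ∫ t in c..d, Real.exp (l * E' t) := intervalIntegral.integral_const_mul _ _
            _ ≤ _ := by
                have := ih (p + 4 * w) hp' c d hcA hcd hdB h3
                have : 0 < s := Real.exp_pos _
                gcongr
        have I2 : s * (d - c) ≤ (∫ t in c..d, Real.exp (l * Y t)) + δ * (d - c) := by
          have : ∫ t in c..d, s ≤ ∫ t in c..d, (Real.exp (l * Y t) + δ) := by
            apply intervalIntegral.integral_mono_on hcd intervalIntegrable_const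
              ((iY c d).add intervalIntegrable_const)
            intro t ht
            exact dn t ht.1 ht.2
          rw [intervalIntegral.integral_add (iY c d) intervalIntegrable_const] at this
          simp only [intervalIntegral.integral_const, smul_eq_mul] at this
          linarith
        have hk : 0 ≤ κ ^ m := pow_nonneg hκ0 m
        calc _ ≤ _ := I1
          _ = κ ^ m * (s * (d - c) + δ * (d - c)) := by ring
          _ ≤ κ ^ m * ((∫ t in c..d, Real.exp (l * Y t)) + δ * (d - c) + δ * (d - c)) := by gcongr
          _ = κ ^ m * ((∫ t in c..d, Real.exp (l * Y t)) + 2 * δ * (d - c)) := by ring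
          _ ≤ κ ^ m * ((∫ t in c..d, Real.exp (l * Y t)) + 2 * δ * (2 / D (p + 4 * w) x)) := by gcongr
          _ = _ := by rw [hδ]; ring
      refine claimQ.trans ?_
      have hk : 0 ≤ κ ^ m := pow_nonneg hκ0 m
      have low := h.unit_low hq hx hxy hy h1 h2
      have pq := h.pos _ hq x hx (hxy.trans hy)
      have ra := h.ratio (p + 3 * w) (p + 4 * w) hq (by omega) x hx (hxy.trans hy)
      have : p + 4 * w - (p + 3 * w) = w := by omega
      rw [this] at ra
      have hd : 1 / D (p + 4 * w) x ≤ (A ^ w)⁻¹ * (3 * (y - x)) := by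
        calc 1 / D (p + 4 * w) x ≤ 1 / (A ^ w * D (p + 3 * w) x) := by gcongr
          _ = (A ^ w)⁻¹ * (1 / D (p + 3 * w) x) := by field_simp
          _ ≤ _ := by gcongr
      have fin : 12 * l / D (p + 4 * w) x * (TY y - TY x) ≤
          l * (2 * w) * (36 * V * (A ^ w)⁻¹) * (y - x) := by
        calc _ = 12 * l * (1 / D (p + 4 * w) x) * (TY y - TY x) := by ring
          _ ≤ 12 * l * (1 / D (p + 4 * w) x) * (2 * w * V) := by gcongr
          _ ≤ 12 * l * ((A ^ w)⁻¹ * (3 * (y - x))) * (2 * w * V) := by gcongr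
          _ = _ := by ring
      gcongr
    refine claimJ.trans ?_
    have be := block_exp h hr hσ0 hσ hp hl hlM ha hab hb h1 h2
    have hk : 0 ≤ κ ^ m := pow_nonneg hκ0 m
    rw [pow_succ, mul_assoc (κ ^ m) κ]
    apply mul_le_mul_of_nonneg_left _ hk
    rw [hκ]
    have be' : (∫ t in a..b, Real.exp (l * Y t)) ≤ _ := be
    linarith
end est


section ld
variable {A B : ℝ} {p0 : ℕ} {φ D : ℕ → ℝ → ℝ} {r T : ℝ → ℝ} {V M β : ℝ}

lemma Rh.neg (h : Rh r T V M β) : Rh (fun x => - r x) T V M β where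
  meas := h.meas.neg
  per := fun x => by simp [h.per x]
  mean := by rw [intervalIntegral.integral_neg, h.mean, neg_zero]
  ctrl := fun x y hxy => by
    have := h.ctrl x y hxy
    rwa [show - r y - - r x = -(r y - r x) by ring, abs_neg]
  var := h.var
  bdd := fun x => by rw [abs_neg]; exact h.bdd x
  sq := by simpa using h.sq

lemma sum_Ioc_split (g : ℕ → ℝ) {a b c : ℕ} (h1 : a ≤ b) (h2 : b ≤ c) :
    ∑ n ∈ Finset.Ioc a c, g n = ∑ n ∈ Finset.Ioc a b, g n + ∑ n ∈ Finset.Ioc b c, g n :=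
  (Finset.sum_Ioc_consecutive g h1 h2).symm

lemma window_split (g : ℕ → ℝ → ℝ) (w m : ℕ) (x : ℝ) : ∀ p,
    ∑ n ∈ Finset.Ioc (p + w) (p + w + 4 * w * m), g n x = Esum g w m p x + Esum g w m (p + 2 * w) x := by
  induction m with
  | zero => intro p; simp [Esum]
  | succ m ih =>
    intro p
    have := ih (p + 4 * w)
    simp only [Esum]
    rw [show p + 2 * w + 4 * w = p + 4 * w + 2 * w by ring,
      sum_Ioc_split (fun n => g n x) (show p + w ≤ p + 3 * w by omega) (show p + 3 * w ≤ p + w + 4 * w * (m+1) by nlinarith),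
      sum_Ioc_split (fun n => g n x) (show p + 3 * w ≤ p + 4 * w + w by omega) (show p + 4 * w + w ≤ p + w + 4 * w * (m+1) by nlinarith),
      show p + w + 4 * w * (m + 1) = p + 4 * w + w + 4 * w * m by ring, this]
    rw [show p + 2 * w + w = p + 3 * w by ring, show p + 2 * w + 3 * w = p + 4 * w + w by ring]
    ring

lemma exp_window (h : Ph A B p0 φ D) (hB : B - A = 1) (hr : Rh r T V M β) {σ : ℝ} (hσ0 : 0 ≤ σ)
    (hσ : 36 * β * √β * (M + V) ≤ σ ^ 2) {w m p : ℕ} (hp : p0 ≤ p) {l : ℝ} (hl : 0 ≤ l)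
    (hlM : 4 * l * w * M ≤ 1) :
    ∫ t in A..B, Real.exp (l * ∑ n ∈ Finset.Ioc (p + w) (p + w + 4 * w * m), r (φ n t)) ≤
     Real.exp ((4 * w * m) * (2 * l ^ 2 * (2 * σ / (1 - √A⁻¹)) + l * ((6 * √β + 36 * V) * (A ^ w)⁻¹))) := by
  have hA := h.hA
  have hAB := h.hAB
  have hAw : 0 < A ^ w := pow_pos (by linarith) _
  have q1 : √A⁻¹ < 1 := by
    rw [Real.sqrt_lt' one_pos, one_pow]; exact inv_lt_one_of_one_lt₀ hA
  have q2 : 0 < 1 - √A⁻¹ := by linarith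
  have V0 := hr.V0
  obtain ⟨κ, hκ⟩ : ∃ κ, κ = 1 + (2 * l) * (2 * w) * ((6 * √β + 36 * V) * (A ^ w)⁻¹) + (2 * l) ^ 2 * (2 * w * (2 * σ / (1 - √A⁻¹))) := ⟨_, rfl⟩
  have hκ0 : 0 ≤ κ := by rw [hκ]; positivity
  have ms := main_step h hr hσ0 hσ (w := w) (l := 2 * l) (by positivity) (by linarith) κ hκ m
  have m1 := ms p hp A B le_rfl hAB le_rfl (h.full _ hp)
  have m2 := ms (p + 2 * w) (by omega) A B le_rfl hAB le_rfl (h.full _ (by omega))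
  rw [hB, mul_one] at m1 m2
  obtain ⟨C, hC⟩ := Esum_bdd (φ := φ) hr w m
  have i1 := ii_exp (Esum_meas h hr w m p) (hC p) (2 * l) (by positivity) A B
  have i2 := ii_exp (Esum_meas h hr w m (p + 2 * w)) (hC _) (2 * l) (by positivity) A B
  have hb : ∀ x, |∑ n ∈ Finset.Ioc (p + w) (p + w + 4 * w * m), r (φ n x)| ≤ _ := fun x => abs_block_le hr _ x
  have i0 := ii_exp (meas_block h hr _) hb l hl A B
  calc _ ≤ ∫ t in A..B, (1/2 : ℝ) * (Real.exp (2 * l * Esum (fun n x => r (φ n x)) w m p t) + Real.exp (2 * l * Esum (fun n x => r (φ n x)) w m (p + 2 * w) t)) := by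
        refine intervalIntegral.integral_mono_on hAB i0 ((i1.add i2).const_mul _) (fun x _ => ?_)
        rw [window_split (fun n x => r (φ n x)) w m x p]
        set X := Esum (fun n x => r (φ n x)) w m p x
        set Y := Esum (fun n x => r (φ n x)) w m (p + 2 * w) x
        rw [show l * (X + Y) = l * X + l * Y by ring, show 2 * l * X = l * X + l * X by ring, show 2 * l * Y = l * Y + l * Y by ring, Real.exp_add, Real.exp_add, Real.exp_add]
        nlinarith [sq_nonneg (Real.exp (l * X) - Real.exp (l * Y))]
    _ ≤ κ ^ m := by
        rw [intervalIntegral.integral_const_mul, intervalIntegral.integral_add i1 i2]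
        linarith
    _ ≤ (Real.exp ((2 * l) * (2 * w) * ((6 * √β + 36 * V) * (A ^ w)⁻¹) + (2 * l) ^ 2 * (2 * w * (2 * σ / (1 - √A⁻¹))))) ^ m := by
        refine pow_le_pow_left₀ hκ0 ?_ m
        rw [hκ, add_assoc, add_comm]
        exact Real.add_one_le_exp _
    _ = _ := by
        rw [← Real.exp_nat_mul]; congr 1; ring

lemma markov_exp {F : ℝ → ℝ} {C l t Q : ℝ} (hAB : A ≤ B) (hF : Measurable F) (hb : ∀ x, |F x| ≤ C)
    (hl : 0 ≤ l) (hQ : ∫ x in A..B, Real.exp (l * F x) ≤ Real.exp Q) :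
    volume (Set.Icc A B ∩ {x | t ≤ F x}) ≤ ENNReal.ofReal (Real.exp (Q - l * t)) := by
  have i0 := ii_exp hF hb l hl A B
  rw [intervalIntegral.integral_of_le hAB, ← integral_Icc_eq_integral_Ioc] at hQ
  rw [intervalIntegrable_iff_integrableOn_Icc_of_le hAB] at i0
  have hm : MeasurableSet {x | t ≤ F x} := measurableSet_le measurable_const hF
  have fin : volume (Set.Icc A B ∩ {x | t ≤ F x}) ≠ ⊤ :=
    ((measure_mono Set.inter_subset_left).trans_lt measure_Icc_lt_top).ne
  have mk := mul_meas_ge_le_integral_of_nonneg (μ := volume.restrict (Set.Icc A B))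
    (f := fun x => Real.exp (l * F x)) (Eventually.of_forall fun x => (Real.exp_pos _).le) i0 (Real.exp (l * t))
  have sub : Set.Icc A B ∩ {x | t ≤ F x} ⊆ {x | Real.exp (l * t) ≤ Real.exp (l * F x)} ∩ Set.Icc A B := by
    rintro x ⟨h1, h2⟩
    exact ⟨Real.exp_le_exp.2 (mul_le_mul_of_nonneg_left h2 hl), h1⟩
  have mm : (volume.restrict (Set.Icc A B)).real {x | Real.exp (l * t) ≤ Real.exp (l * F x)} =
     volume.real ({x | Real.exp (l * t) ≤ Real.exp (l * F x)} ∩ Set.Icc A B) := by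
    rw [measureReal_restrict_apply]
    exact measurableSet_le measurable_const (Real.measurable_exp.comp (hF.const_mul l))
  rw [mm] at mk
  have fin2 : volume ({x | Real.exp (l * t) ≤ Real.exp (l * F x)} ∩ Set.Icc A B) ≠ ⊤ :=
    ((measure_mono Set.inter_subset_right).trans_lt measure_Icc_lt_top).ne
  have := measureReal_mono sub fin2
  rw [← ENNReal.ofReal_toReal fin]
  apply ENNReal.ofReal_le_ofReal
  rw [Real.exp_sub, le_div_iff₀ (Real.exp_pos _), mul_comm]
  refine le_trans ?_ (mk.trans hQ)
  exact mul_le_mul_of_nonneg_left this (Real.exp_pos _).le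

/-- large deviation -/
lemma large_dev (h : Ph A B p0 φ D) (hB : B - A = 1) (hr : Rh r T V M β) {σ : ℝ} (hσ0 : 0 ≤ σ)
    (hσ : 36 * β * √β * (M + V) ≤ σ ^ 2) {w m p : ℕ} (hp : p0 ≤ p) {l t : ℝ} (hl : 0 ≤ l)
    (hlM : 4 * l * w * M ≤ 1) :
    volume (Set.Icc A B ∩ {x | t ≤ |∑ n ∈ Finset.Ioc (p + w) (p + w + 4 * w * m), r (φ n x)|}) ≤
     2 * ENNReal.ofReal (Real.exp ((4 * w * m) * (2 * l ^ 2 * (2 * σ / (1 - √A⁻¹)) + l * ((6 * √β + 36 * V) * (A ^ w)⁻¹)) - l * t)) := by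
  have a1 := markov_exp (t := t) h.hAB (meas_block h hr _) (fun x => abs_block_le hr _ x) hl
    (exp_window h hB hr hσ0 hσ (m := m) hp hl hlM)
  have a2 := markov_exp (t := t) h.hAB (meas_block h hr.neg _) (fun x => abs_block_le hr.neg _ x) hl
    (exp_window h hB hr.neg hσ0 hσ (m := m) hp hl hlM)
  rw [two_mul]
  refine le_trans (measure_mono ?_) ((measure_union_le _ _).trans (add_le_add a1 a2))
  rintro x ⟨hx, ht⟩
  rw [Set.mem_setOf_eq] at ht
  rcases le_abs.1 ht with h1 | h1
  · exact Or.inl ⟨hx, h1⟩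
  · refine Or.inr ⟨hx, ?_⟩
    simpa [Finset.sum_neg_distrib] using h1
end ld


lemma chain_det (g : ℕ → ℝ) (a0 E n : ℕ) (hn : n < 2 ^ E) (t : ℕ → ℝ) (Q : ℕ) (hQ : Q ≤ E) (ht : ∀ q, 0 ≤ t q)
    (H : ∀ q, 1 ≤ q → q ≤ Q → ∀ j, j < 2 ^ q →
      |∑ i ∈ Finset.Ioc (a0 + j * 2 ^ (E - q)) (a0 + j * 2 ^ (E - q) + 2 ^ (E - q)), g i| ≤ t q) :
    |∑ i ∈ Finset.Ioc a0 (a0 + n / 2 ^ (E - Q) * 2 ^ (E - Q)), g i| ≤ ∑ q ∈ Finset.Icc 1 Q, t q := by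
  induction Q with
  | zero =>
    simp [Nat.div_eq_of_lt hn]
  | succ Q ih =>
    have ih := ih (by omega) (fun q h1 h2 => H q h1 (by omega))
    rw [Finset.sum_Icc_succ_top (by omega)]
    obtain ⟨e, he⟩ : ∃ e, e = E - (Q + 1) := ⟨_, rfl⟩
    have he' : E - Q = e + 1 := by omega
    rw [← he]
    rw [he'] at ih
    have hd : n / 2 ^ (e + 1) = n / 2 ^ e / 2 := by rw [pow_succ, Nat.div_div_eq_div_mul]
    rw [hd] at ih
    have hlt : n / 2 ^ e < 2 ^ (Q + 1) := by
      rw [Nat.div_lt_iff_lt_mul (by positivity), ← pow_add]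
      rwa [show Q + 1 + e = E by omega]
    have Hq := H (Q + 1) (by omega) le_rfl
    rw [← he] at Hq
    obtain ⟨c, hc⟩ : ∃ c, c = n / 2 ^ e := ⟨_, rfl⟩
    rw [← hc] at ih hlt ⊢
    have tq := ht (Q + 1)
    rcases Nat.even_or_odd' c with ⟨b, hb | hb⟩
    · have : c / 2 * 2 ^ (e + 1) = c * 2 ^ e := by
        rw [hb, pow_succ, Nat.mul_div_cancel_left _ (by norm_num)]; ring
      rw [this] at ih
      linarith
    · have h2 : c / 2 * 2 ^ (e + 1) = (2 * b) * 2 ^ e := by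
        rw [hb, pow_succ, show (2 * b + 1) / 2 = b by omega]; ring
      rw [h2] at ih
      have := Hq (2 * b) (by omega)
      rw [show c * 2 ^ e = 2 * b * 2 ^ e + 2 ^ e by rw [hb]; ring, ← add_assoc,
        sum_Ioc_split g (Nat.le_add_right a0 (2 * b * 2 ^ e)) (Nat.le_add_right (a0 + 2 * b * 2 ^ e) (2 ^ e))]
      exact (abs_add_le _ _).trans (add_le_add ih this)

lemma abs_sum_Ioc_le (g : ℕ → ℝ) {M : ℝ} (hg : ∀ n, |g n| ≤ M) (a b : ℕ) :
    |∑ i ∈ Finset.Ioc a b, g i| ≤ (b - a : ℕ) * M := by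
  refine (Finset.abs_sum_le_sum_abs _ _).trans ?_
  refine (Finset.sum_le_card_nsmul _ _ M (fun n _ => hg _)).trans ?_
  rw [nsmul_eq_mul, Nat.card_Ioc]

lemma chain_det2 (g : ℕ → ℝ) {M : ℝ} (hg : ∀ n, |g n| ≤ M) (k N : ℕ) (h1 : 2 ^ (8 * k) ≤ N) (h2 : N < 2 ^ (8 * k + 8))
    (t : ℕ → ℝ) (ht : ∀ q, 0 ≤ t q)
    (H : ∀ q, 1 ≤ q → q ≤ 4 * k + 8 → ∀ j, j < 2 ^ q →
      |∑ i ∈ Finset.Ioc (2 ^ (4 * k) + j * 2 ^ (8 * k + 8 - q)) (2 ^ (4 * k) + j * 2 ^ (8 * k + 8 - q) + 2 ^ (8 * k + 8 - q)), g i| ≤ t q) :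
    |∑ i ∈ Finset.Icc 1 N, g i| ≤ 2 * M * 2 ^ (4 * k) + ∑ q ∈ Finset.Icc 1 (4 * k + 8), t q := by
  have M0 : 0 ≤ M := (abs_nonneg _).trans (hg 0)
  have h0 : 2 ^ (4 * k) ≤ N := le_trans (Nat.pow_le_pow_right (by norm_num) (by omega)) h1
  have pa : 0 < 2 ^ (4 * k) := by positivity
  have c := chain_det g (2 ^ (4 * k)) (8 * k + 8) (N - 2 ^ (4 * k)) (by omega) t (4 * k + 8) (by omega) ht H
  rw [show 8 * k + 8 - (4 * k + 8) = 4 * k by omega] at c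
  obtain ⟨a, ha⟩ : ∃ a, a = 2 ^ (4 * k) := ⟨_, rfl⟩
  rw [← ha] at c h0
  have ap : 0 < a := by rw [ha]; positivity
  obtain ⟨b, hb⟩ : ∃ b, b = a + (N - a) / a * a := ⟨_, rfl⟩
  rw [← hb] at c
  have e1 : b ≤ N := by
    have := Nat.div_mul_le_self (N - a) a
    omega
  have e2 : N - b ≤ a := by
    have := Nat.mod_lt (N - a) ap
    have := Nat.div_add_mod' (N - a) a
    omega
  have i1 : Finset.Icc 1 N = Finset.Ioc 0 N := by ext; simp [Nat.lt_iff_add_one_le]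
  rw [i1, sum_Ioc_split g (Nat.zero_le a) h0, sum_Ioc_split g (show a ≤ b by omega) e1]
  have f1 := abs_sum_Ioc_le g hg 0 a
  have f2 := abs_sum_Ioc_le g hg b N
  have f3 : ((N - b : ℕ) : ℝ) ≤ a := by exact_mod_cast e2
  have f4 : (a : ℝ) = 2 ^ (4 * k) := by rw [ha]; push_cast; rfl
  rw [Nat.sub_zero] at f1
  rw [← f4]
  have f5 := mul_le_mul_of_nonneg_right f3 M0
  have := abs_add_le (∑ i ∈ Finset.Ioc 0 a, g i) (∑ i ∈ Finset.Ioc a b, g i + ∑ i ∈ Finset.Ioc b N, g i)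
  have := abs_add_le (∑ i ∈ Finset.Ioc a b, g i) (∑ i ∈ Finset.Ioc b N, g i)
  linarith

noncomputable def tt (s : ℝ) (k q : ℕ) : ℝ := 128 * s * (2 ^ (4 * k) * √(Real.log k)) * (4 / 5) ^ q

lemma tt_nonneg {s : ℝ} (hs : 0 < s) (k q : ℕ) : 0 ≤ tt s k q := by unfold tt; positivity

lemma tt_sum {s : ℝ} (hs : 0 < s) (k n : ℕ) :
    ∑ q ∈ Finset.Icc 1 n, tt s k q ≤ 512 * s * (2 ^ (4 * k) * √(Real.log k)) := by
  have : ∀ n : ℕ, ∑ q ∈ Finset.Icc 1 n, (4 / 5 : ℝ) ^ q = 4 - 4 * (4 / 5) ^ n := by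
    intro n
    induction n with
    | zero => simp
    | succ n ih => rw [Finset.sum_Icc_succ_top (by omega), ih]; ring
  unfold tt
  rw [← Finset.mul_sum, this]
  have h1 : 0 ≤ s * (2 ^ (4 * k) * √(Real.log k)) := by positivity
  have h2 : (0:ℝ) ≤ (4 / 5) ^ n := by positivity
  nlinarith [mul_nonneg h1 h2]

lemma sqrt_log_le (k : ℕ) : √(Real.log k) ≤ k := by
  rw [Real.sqrt_le_left (by positivity)]
  rcases Nat.eq_zero_or_pos k with h | h
  · simp [h]
  · have h1 : (1:ℝ) ≤ k := by exact_mod_cast h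
    have := Real.log_le_self (show (0:ℝ) ≤ k by positivity)
    nlinarith

lemma ev_conds {A s M K : ℝ} (hA : 1 < A) (hs : 0 < s) (p0 : ℕ) :
    ∀ᶠ k : ℕ in atTop, 1 ≤ Real.log k ∧ 2 * M ≤ s * √(Real.log k) ∧ p0 + 2 ^ k ≤ 2 ^ (4 * k) ∧ 1 ≤ k ∧
      M / (2 * s) * (8 / 5) ^ 8 * (k * (512 / 625) ^ k) ≤ 1 ∧
      32 * K / s * (((2:ℝ) ^ k) ^ 5 / A ^ (2 ^ k)) ≤ 1 := by
  have hlog : Tendsto (fun k : ℕ => Real.log k) atTop atTop := Real.tendsto_log_atTop.comp tendsto_natCast_atTop_atTop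
  have c1 := hlog.eventually_ge_atTop 1
  have c2 := ((Real.tendsto_sqrt_atTop.comp hlog).const_mul_atTop hs).eventually_ge_atTop (2 * M)
  have c3 : ∀ᶠ k : ℕ in atTop, p0 + 2 ^ k ≤ 2 ^ (4 * k) := by
    filter_upwards [eventually_ge_atTop (p0 + 1)] with k hk
    have : k < 2 ^ k := Nat.lt_two_pow_self
    have : 2 * 2 ^ k ≤ 2 ^ (4 * k) := by
      rw [← pow_succ']; exact Nat.pow_le_pow_right (by norm_num) (by omega)
    omega
  have c5 : Tendsto (fun k : ℕ => M / (2 * s) * (8 / 5) ^ 8 * (k * (512 / 625 : ℝ) ^ k)) atTop (nhds 0) := by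
    have := (tendsto_self_mul_const_pow_of_lt_one (r := (512/625 : ℝ)) (by norm_num) (by norm_num)).const_mul (M / (2 * s) * (8 / 5) ^ 8)
    simpa using this
  have c6 : Tendsto (fun k : ℕ => 32 * K / s * (((2:ℝ) ^ k) ^ 5 / A ^ (2 ^ k))) atTop (nhds 0) := by
    have h1 := tendsto_pow_const_div_const_pow_of_one_lt 5 hA
    have h2 : Tendsto (fun k : ℕ => 2 ^ k) atTop atTop := tendsto_pow_atTop_atTop_of_one_lt (by norm_num : 1 < 2)
    have := (h1.comp h2).const_mul (32 * K / s)
    simpa [Function.comp_def] using this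
  filter_upwards [c1, c2, c3, eventually_ge_atTop 1, c5.eventually_le_const one_pos, c6.eventually_le_const one_pos] with k a1 a2 a3 a4 a5 a6
  exact ⟨a1, a2, a3, a4, a5, a6⟩

section bc
variable {A B : ℝ} {p0 : ℕ} {φ D : ℕ → ℝ → ℝ} {r T : ℝ → ℝ} {V M β : ℝ}

lemma one_window (h : Ph A B p0 φ D) (hB : B - A = 1) (hr : Rh r T V M β) {σ s : ℝ} (hσ0 : 0 ≤ σ)
    (hσ : 36 * β * √β * (M + V) ≤ σ ^ 2) (hs : 0 < s) (hs2 : 2 * σ / (1 - √A⁻¹) = s ^ 2)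
    {k q j : ℕ} (hq : 1 ≤ q) (hqk : q ≤ 4 * k + 8) (L1 : 1 ≤ Real.log k)
    (c3 : p0 + 2 ^ k ≤ 2 ^ (4 * k)) (c4 : 1 ≤ k)
    (c5 : M / (2 * s) * (8 / 5) ^ 8 * (k * (512 / 625) ^ k) ≤ 1)
    (c6 : 32 * (6 * √β + 36 * V) / s * (((2:ℝ) ^ k) ^ 5 / A ^ (2 ^ k)) ≤ 1) :
    volume (Set.Icc A B ∩ {x | tt s k q ≤ |∑ i ∈ Finset.Ioc (2 ^ (4 * k) + j * 2 ^ (8 * k + 8 - q)) (2 ^ (4 * k) + j * 2 ^ (8 * k + 8 - q) + 2 ^ (8 * k + 8 - q)), r (φ i x)|}) ≤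
     2 * ENNReal.ofReal (Real.exp (1 - 2 * Real.log k - 2 * q)) := by
  obtain ⟨K, hK⟩ : ∃ K, K = 6 * √β + 36 * V := ⟨_, rfl⟩
  have V0 := hr.V0
  have M0 := hr.M0
  have K0 : 0 ≤ K := by rw [hK]; positivity
  have A0 : 0 < A := by linarith [h.hA]
  obtain ⟨H, hH⟩ : ∃ H : ℝ, H = 2 ^ (8 * k + 8 - q) := ⟨_, rfl⟩
  have H0 : 0 < H := by rw [hH]; positivity
  have Hq : H * 2 ^ q = 256 * 2 ^ (4 * k) * 2 ^ (4 * k) := by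
    rw [hH, ← pow_add, show 8 * k + 8 - q + q = 4 * k + 4 * k + 8 by omega, pow_add, pow_add]; norm_num; ring
  have kR : √(Real.log k) ≤ k := sqrt_log_le k
  obtain ⟨R, hR⟩ : ∃ R, R = √(Real.log k) := ⟨_, rfl⟩
  have R0 : 0 ≤ R := by rw [hR]; positivity
  have R2 : R ^ 2 = Real.log k := by rw [hR, Real.sq_sqrt (by linarith)]
  rw [← hR] at kR
  obtain ⟨P, hP⟩ : ∃ P : ℝ, P = 2 ^ (4 * k) := ⟨_, rfl⟩
  have P0 : 0 < P := by rw [hP]; positivity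
  rw [← hP] at Hq
  have htt : tt s k q = 128 * s * (P * R) * (4 / 5) ^ q := by rw [tt, hR, hP]
  have tt0 := tt_nonneg hs k q
  obtain ⟨l, hl⟩ : ∃ l, l = tt s k q / (4 * H * s ^ 2) := ⟨_, rfl⟩
  have l0 : 0 ≤ l := by rw [hl]; positivity
  have H1 : H = 256 * P * P / 2 ^ q := by rw [← Hq]; field_simp
  have leq : l = R * (8 / 5) ^ q / (8 * P * s) := by
    rw [hl, htt, H1, show (8/5 : ℝ) = 2 * (4 / 5) by norm_num, mul_pow]
    field_simp
    ring
  have P16 : P = 16 ^ k := by rw [hP, pow_mul]; norm_num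
  have hlM : 4 * l * (2 ^ k : ℕ) * M ≤ 1 := by
    refine le_trans ?_ c5
    have e : M / (2 * s) * (8 / 5) ^ 8 * (k * (512 / 625 : ℝ) ^ k) = 4 * ((k * (8 / 5) ^ (4 * k + 8)) / (8 * P * s)) * 2 ^ k * M := by
      have e' : (512 / 625 : ℝ) ^ k = ((8 / 5) ^ 4) ^ k * 2 ^ k / 16 ^ k := by
        rw [← mul_pow, ← div_pow]; norm_num
      rw [pow_add, pow_mul, P16, e']
      generalize ((8 / 5 : ℝ) ^ 4) ^ k = y
      generalize (8 / 5 : ℝ) ^ 8 = z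
      field_simp
      ring
    rw [e, leq]
    push_cast
    have : (8 / 5 : ℝ) ^ q ≤ (8 / 5) ^ (4 * k + 8) := pow_le_pow_right₀ (by norm_num) hqk
    gcongr
  have hw : 4 * 2 ^ k * 2 ^ (8 * k + 8 - q - 2 - k) = 2 ^ (8 * k + 8 - q) := by
    rw [show 4 = 2 ^ 2 by norm_num, ← pow_add, ← pow_add]; congr 1; omega
  have hp : 2 ^ (4 * k) - 2 ^ k + j * 2 ^ (8 * k + 8 - q) + 2 ^ k = 2 ^ (4 * k) + j * 2 ^ (8 * k + 8 - q) := by omega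
  have ld := large_dev h hB hr hσ0 hσ (w := 2 ^ k) (m := 2 ^ (8 * k + 8 - q - 2 - k))
    (p := 2 ^ (4 * k) - 2 ^ k + j * 2 ^ (8 * k + 8 - q)) (by omega) (t := tt s k q) l0 hlM
  rw [hw, hp] at ld
  have hwR : (4 * ((2 ^ k : ℕ) : ℝ) * ((2 ^ (8 * k + 8 - q - 2 - k) : ℕ) : ℝ)) = H := by
    rw [hH]; exact_mod_cast hw
  rw [hwR, hs2, ← hK] at ld
  refine ld.trans (mul_le_mul_right (ENNReal.ofReal_le_ofReal (Real.exp_le_exp.2 ?_)) _)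
  have e1 : H * (2 * l ^ 2 * s ^ 2) - l * tt s k q = - (tt s k q ^ 2 / (8 * H * s ^ 2)) := by
    rw [hl]; field_simp; ring
  have e2 : tt s k q ^ 2 / (8 * H * s ^ 2) = 8 * Real.log k * (32 / 25) ^ q := by
    have e' : (32 / 25 : ℝ) ^ q = 2 ^ q * ((4 / 5) ^ q * (4 / 5) ^ q) := by
      rw [← mul_pow, ← mul_pow]; norm_num
    rw [htt, H1, ← R2, e']
    generalize (4 / 5 : ℝ) ^ q = y
    field_simp
    ring
  have e3 : (1 : ℝ) + q * (7 / 25) ≤ (32 / 25) ^ q := by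
    have := one_add_mul_le_pow (show (-2 : ℝ) ≤ 7 / 25 by norm_num) q
    norm_num at this ⊢
    linarith
  have e4 : 2 * Real.log k + 2 * q ≤ 8 * Real.log k * (32 / 25) ^ q := by
    have : 8 * Real.log k * (1 + q * (7 / 25)) ≤ 8 * Real.log k * (32 / 25) ^ q := by gcongr
    have q0 : (0:ℝ) ≤ q := by positivity
    nlinarith
  have e5 : H * (l * (K * (A ^ 2 ^ k)⁻¹)) ≤ 1 := by
    refine le_trans ?_ c6
    rw [← hK]
    have : H * l = 32 * P * R * (4 / 5) ^ q / s := by rw [hl, htt]; field_simp; ring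
    have b1 : (4 / 5 : ℝ) ^ q ≤ 1 := pow_le_one₀ (by norm_num) (by norm_num)
    have b2 : R ≤ 2 ^ k := by
      refine kR.trans ?_
      exact_mod_cast (Nat.lt_two_pow_self (n := k)).le
    have b3 : P = ((2:ℝ) ^ k) ^ 4 := by rw [hP, ← pow_mul]; congr 1; ring
    calc H * (l * (K * (A ^ 2 ^ k)⁻¹)) = (H * l) * (K * (A ^ 2 ^ k)⁻¹) := by ring
      _ = 32 * P * R * (4 / 5) ^ q / s * (K * (A ^ 2 ^ k)⁻¹) := by rw [this]
      _ ≤ 32 * P * 2 ^ k * 1 / s * (K * (A ^ 2 ^ k)⁻¹) := by gcongr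
      _ = _ := by rw [b3]; field_simp
  have : H * (2 * l ^ 2 * s ^ 2 + l * (K * (A ^ 2 ^ k)⁻¹)) = H * (2 * l ^ 2 * s ^ 2) + H * (l * (K * (A ^ 2 ^ k)⁻¹)) := by ring
  rw [this]
  linarith

def Bad (A B : ℝ) (g : ℕ → ℝ → ℝ) (s : ℝ) (k : ℕ) : Set ℝ :=
  ⋃ q ∈ Finset.Icc 1 (4 * k + 8), ⋃ j ∈ Finset.range (2 ^ q), Set.Icc A B ∩ {x | tt s k q ≤ |∑ i ∈ Finset.Ioc (2 ^ (4 * k) + j * 2 ^ (8 * k + 8 - q)) (2 ^ (4 * k) + j * 2 ^ (8 * k + 8 - q) + 2 ^ (8 * k + 8 - q)), g i x|}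

lemma bad_meas (h : Ph A B p0 φ D) (hB : B - A = 1) (hr : Rh r T V M β) {σ s : ℝ} (hσ0 : 0 ≤ σ)
    (hσ : 36 * β * √β * (M + V) ≤ σ ^ 2) (hs : 0 < s) (hs2 : 2 * σ / (1 - √A⁻¹) = s ^ 2)
    {k : ℕ} (L1 : 1 ≤ Real.log k)
    (c3 : p0 + 2 ^ k ≤ 2 ^ (4 * k)) (c4 : 1 ≤ k)
    (c5 : M / (2 * s) * (8 / 5) ^ 8 * (k * (512 / 625) ^ k) ≤ 1)
    (c6 : 32 * (6 * √β + 36 * V) / s * (((2:ℝ) ^ k) ^ 5 / A ^ (2 ^ k)) ≤ 1) :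
    volume (Bad A B (fun i x => r (φ i x)) s k) ≤ ENNReal.ofReal (6 * (1 / (k:ℝ) ^ 2)) := by
  have k0 : (0:ℝ) < k := by exact_mod_cast c4
  have ek : Real.exp (1 - 2 * Real.log k) ≤ 3 * (1 / (k:ℝ) ^ 2) := by
    rw [Real.exp_sub, mul_comm 2, Real.exp_mul, Real.exp_log k0, mul_one_div]
    norm_cast
    have := Real.exp_one_lt_d9
    gcongr
    norm_num at this ⊢; linarith
  have e4 : (4:ℝ) ≤ Real.exp 2 := by
    have := Real.exp_one_gt_d9
    rw [show (2:ℝ) = 1 + 1 by norm_num, Real.exp_add]; nlinarith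
  have geo : ∀ n : ℕ, ∑ q ∈ Finset.Icc 1 n, (1 / 2 : ℝ) ^ q = 1 - (1 / 2) ^ n := by
    intro n
    induction n with
    | zero => simp
    | succ n ih => rw [Finset.sum_Icc_succ_top (by omega), ih]; ring
  calc volume (Bad A B (fun i x => r (φ i x)) s k)
      ≤ ∑ q ∈ Finset.Icc 1 (4 * k + 8), ∑ j ∈ Finset.range (2 ^ q), 2 * ENNReal.ofReal (Real.exp (1 - 2 * Real.log k - 2 * q)) := by
        refine (measure_biUnion_finset_le _ _).trans (Finset.sum_le_sum fun q hq => ?_)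
        refine (measure_biUnion_finset_le _ _).trans (Finset.sum_le_sum fun j _ => ?_)
        rw [Finset.mem_Icc] at hq
        exact one_window h hB hr hσ0 hσ hs hs2 hq.1 hq.2 L1 c3 c4 c5 c6
    _ ≤ ∑ q ∈ Finset.Icc 1 (4 * k + 8), ENNReal.ofReal (6 * (1 / (k:ℝ) ^ 2) * (1 / 2) ^ q) := by
        refine Finset.sum_le_sum fun q _ => ?_
        rw [Finset.sum_const, Finset.card_range, nsmul_eq_mul]
        rw [show (((2 ^ q : ℕ) : ENNReal)) = ENNReal.ofReal (2 ^ q) by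
          rw [ENNReal.ofReal_pow (by norm_num)]; simp, show (2 : ENNReal) = ENNReal.ofReal 2 by simp,
          ← ENNReal.ofReal_mul (by norm_num), ← ENNReal.ofReal_mul (by positivity)]
        apply ENNReal.ofReal_le_ofReal
        rw [Real.exp_sub, show (2 * (q:ℝ)) = q * 2 by ring, Real.exp_nat_mul]
        have : (4:ℝ) ^ q ≤ Real.exp 2 ^ q := by gcongr
        calc (2:ℝ) ^ q * (2 * (Real.exp (1 - 2 * Real.log k) / Real.exp 2 ^ q)) ≤ 2 ^ q * (2 * (3 * (1 / (k:ℝ) ^ 2) / 4 ^ q)) := by gcongr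
          _ = _ := by rw [show (4:ℝ) = 2 * 2 by norm_num, mul_pow, one_div_pow]; field_simp; ring
    _ = ENNReal.ofReal (∑ q ∈ Finset.Icc 1 (4 * k + 8), (6 * (1 / (k:ℝ) ^ 2) * (1 / 2) ^ q)) := by
        rw [ENNReal.ofReal_sum_of_nonneg]; intros; positivity
    _ ≤ _ := by
        apply ENNReal.ofReal_le_ofReal
        rw [← Finset.mul_sum, geo]
        have : (0:ℝ) ≤ (1/2) ^ (4 * k + 8) := by positivity
        have : (0:ℝ) ≤ 6 * (1 / (k:ℝ) ^ 2) := by positivity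
        nlinarith

lemma final_limsup (h : Ph A B p0 φ D) (hB : B - A = 1) (hr : Rh r T V M β) {σ s : ℝ} (hσ0 : 0 ≤ σ)
    (hσ : 36 * β * √β * (M + V) ≤ σ ^ 2) (hs : 0 < s) (hs2 : 2 * σ / (1 - √A⁻¹) = s ^ 2) :
    ∀ᵐ x : ℝ ∂volume, x ∈ Set.Icc A B → ∀ᶠ N : ℕ in atTop,
      |∑ n ∈ Finset.Icc 1 N, r (φ n x)| / √(N * (max 1 (Real.log (max 1 (Real.log N))))) ≤ 513 * s := by
  obtain ⟨k0, hk0⟩ := eventually_atTop.1 (ev_conds (M := M) (K := 6 * √β + 36 * V) h.hA hs p0)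
  have sum : ∑' k : ℕ, volume (Bad A B (fun i x => r (φ i x)) s (k + k0)) ≠ ⊤ := by
    have sm : Summable (fun k : ℕ => 6 * (1 / ((k + k0 : ℕ):ℝ) ^ 2)) :=
      ((summable_nat_add_iff k0).2 (Real.summable_one_div_nat_pow.2 (by norm_num : 1 < 2))).mul_left 6
    refine ne_top_of_le_ne_top ?_ (ENNReal.tsum_le_tsum (g := fun k => ENNReal.ofReal (6 * (1 / ((k + k0 : ℕ):ℝ) ^ 2))) fun k => ?_)
    · exact sm.tsum_ofReal_ne_top
    · obtain ⟨a1, a2, a3, a4, a5, a6⟩ := hk0 (k + k0) (by omega)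
      exact bad_meas h hB hr hσ0 hσ hs hs2 a1 a3 a4 a5 a6
  filter_upwards [ae_eventually_notMem sum] with x hx hxAB
  obtain ⟨k1, hk1⟩ := eventually_atTop.1 hx
  filter_upwards [eventually_ge_atTop (2 ^ (8 * (k0 + k1)))] with N hN
  obtain ⟨k, hk⟩ : ∃ k, k = Nat.log 2 N / 8 := ⟨_, rfl⟩
  have N0 : N ≠ 0 := by
    have : 0 < 2 ^ (8 * (k0 + k1)) := by positivity
    omega
  have lo : 2 ^ (8 * k) ≤ N := (Nat.pow_le_pow_right (by norm_num) (by omega)).trans (Nat.pow_log_le_self 2 N0)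
  have hi : N < 2 ^ (8 * k + 8) := (Nat.lt_pow_succ_log_self (by norm_num) N).trans_le (Nat.pow_le_pow_right (by norm_num) (by omega))
  have kk : k0 + k1 ≤ k := by
    have : 8 * (k0 + k1) ≤ Nat.log 2 N := Nat.le_log_of_pow_le (by norm_num) hN
    omega
  obtain ⟨a1, a2, a3, a4, a5, a6⟩ := hk0 k (by omega)
  have nb := hk1 (k - k0) (by omega)
  rw [Nat.sub_add_cancel (by omega)] at nb
  have H := chain_det2 (fun n => r (φ n x)) (fun n => hr.bdd _) k N lo hi (tt s k) (tt_nonneg hs k) (by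
    intro q h1 h2 j hj
    by_contra hc
    push Not at hc
    apply nb
    simp only [Bad, Set.mem_iUnion]
    exact ⟨q, Finset.mem_Icc.2 ⟨h1, h2⟩, j, Finset.mem_range.2 hj, hxAB, hc.le⟩)
  have ts := tt_sum hs k (4 * k + 8)
  have k0' : (0:ℝ) < k := by exact_mod_cast a4
  have loR : (2:ℝ) ^ (8 * k) ≤ N := by exact_mod_cast lo
  have lN : (k:ℝ) ≤ Real.log N := by
    have := Real.log_le_log (by positivity) loR
    rw [Real.log_pow] at this
    push_cast at this
    have := Real.log_two_gt_d9
    nlinarith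
  have ll : Real.log k ≤ max 1 (Real.log (max 1 (Real.log N))) :=
    le_max_of_le_right (Real.log_le_log k0' (le_max_of_le_right lN))
  have sq : 2 ^ (4 * k) * √(Real.log k) ≤ √(N * (max 1 (Real.log (max 1 (Real.log N))))) := by
    apply Real.le_sqrt_of_sq_le
    rw [mul_pow, Real.sq_sqrt (by linarith), ← pow_mul, show 4 * k * 2 = 8 * k by ring]
    gcongr
  have pos : 0 < 2 ^ (4 * k) * √(Real.log k) := by
    have : 0 < √(Real.log k) := Real.sqrt_pos.2 (by linarith)
    positivity
  rw [div_le_iff₀ (pos.trans_le sq)]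
  have p4 : (0:ℝ) < 2 ^ (4 * k) := by positivity
  calc _ ≤ _ := H
    _ ≤ (s * √(Real.log k)) * 2 ^ (4 * k) + 512 * s * (2 ^ (4 * k) * √(Real.log k)) := by gcongr
    _ = 513 * s * (2 ^ (4 * k) * √(Real.log k)) := by ring
    _ ≤ _ := by gcongr
end bc


lemma ph_inst {ξ A B : ℝ} (hξ : 0 < ξ) (hA : 1 < A) (hAB : B - A = 1) {s : ℕ → ℕ} (hs : StrictMono s) :
    ∃ p0, Ph A B p0 (fun n x => ξ * x ^ s n) (fun n x => ξ * (s n * x ^ (s n - 1))) := by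
  have A0 : 0 < A := by linarith
  obtain ⟨p, hp⟩ := pow_unbounded_of_one_lt (1 / ξ) hA
  have hp1 : ∀ q, p ≤ q → 1 ≤ ξ * A ^ q := fun q hq => by
    have : A ^ p ≤ A ^ q := pow_le_pow_right₀ hA.le hq
    rw [div_lt_iff₀ hξ] at hp
    nlinarith
  have sn : ∀ n, p + 1 ≤ n → p + 1 ≤ s n := fun n hn => hn.trans hs.le_apply
  have split : ∀ n, p + 1 ≤ n → ∀ x : ℝ, x ^ s n = x * x ^ (s n - 1) := fun n hn x => by
    rw [← pow_succ']; congr 1; have := sn n hn; omega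
  refine ⟨p + 1, hA, by linarith, ?_, ?_, ?_, ?_, ?_, ?_, ?_⟩
  · intro n x
    exact (hasDerivAt_pow (s n) x).const_mul ξ
  · intro n; fun_prop
  · intro n hn x hx _
    have := sn n hn
    have h1 : (0:ℝ) < s n := by exact_mod_cast (by omega : 0 < s n)
    have : 0 < x := by linarith
    positivity
  · intro n hn x y hx hxy _
    have : 0 < x := by linarith
    show ξ * (s n * x ^ (s n - 1)) ≤ ξ * (s n * y ^ (s n - 1))
    gcongr
  · intro m n hm hmn x hx _
    have x0 : 0 < x := by linarith
    have h1 := hs.add_le_nat (n - m) m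
    rw [Nat.sub_add_cancel hmn] at h1
    have h2 : s n - 1 = (s n - s m) + (s m - 1) := by have := sn m hm; omega
    have h3 : A ^ (n - m) ≤ x ^ (s n - s m) :=
      calc A ^ (n - m) ≤ A ^ (s n - s m) := pow_le_pow_right₀ hA.le (by omega)
        _ ≤ _ := by gcongr
    have h4 : (s m : ℝ) ≤ s n := by exact_mod_cast hs.monotone hmn
    show A ^ (n - m) * (ξ * (s m * x ^ (s m - 1))) ≤ ξ * (s n * x ^ (s n - 1))
    rw [h2, pow_add]
    calc A ^ (n - m) * (ξ * (s m * x ^ (s m - 1))) = ξ * (s m * (A ^ (n - m) * x ^ (s m - 1))) := by ring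
      _ ≤ _ := by gcongr
  · intro n hn u v hu huv hv h2
    have u0 : 0 < u := by linarith
    have v0 : 0 < v := by linarith
    have h2 : ξ * v ^ s n - ξ * u ^ s n ≤ 2 := h2
    have h1 : 1 ≤ ξ * u ^ s n := (hp1 (s n) (by have := sn n hn; omega)).trans (by gcongr)
    show ξ * (s n * v ^ (s n - 1)) ≤ 3 * (ξ * (s n * u ^ (s n - 1)))
    have h3 : ξ * v ^ s n ≤ 3 * (ξ * u ^ s n) := by linarith
    rw [split n hn, split n hn] at h3
    have h4 : v * (ξ * v ^ (s n - 1)) ≤ v * (3 * (ξ * u ^ (s n - 1))) := by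
      have : u * (3 * (ξ * u ^ (s n - 1))) ≤ v * (3 * (ξ * u ^ (s n - 1))) := by gcongr
      linarith
    have h5 := le_of_mul_le_mul_left h4 v0
    have : (0:ℝ) ≤ s n := by positivity
    nlinarith
  · intro n hn
    show 1 ≤ ξ * B ^ s n - ξ * A ^ s n
    rw [split n hn, split n hn]
    have h1 := hp1 (s n - 1) (by have := sn n hn; omega)
    have h2 : A ^ (s n - 1) ≤ B ^ (s n - 1) := pow_le_pow_left₀ A0.le (by linarith) _
    have h3 : ξ * (B * A ^ (s n - 1)) ≤ ξ * (B * B ^ (s n - 1)) := by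
      have : 0 < B := by linarith
      gcongr
    have h4 : ξ * (B * A ^ (s n - 1)) - ξ * (A * A ^ (s n - 1)) = (B - A) * (ξ * A ^ (s n - 1)) := by ring
    rw [hAB] at h4
    linarith


noncomputable def Wv (f : ℝ → ℝ) (x : ℝ) : ℝ := (eVariationOn f (Set.Icc 0 x)).toReal
noncomputable def Tf (f : ℝ → ℝ) (x : ℝ) : ℝ := 2 * ⌊x⌋ + Wv f (Int.fract x)

lemma ev_ne {f : ℝ → ℝ} (hv : eVariationOn f (Set.Icc (0:ℝ) 1) ≤ 2) {a b : ℝ} (ha : 0 ≤ a) (hb : b ≤ 1) : eVariationOn f (Set.Icc a b) ≠ ⊤ :=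
  ne_top_of_le_ne_top (by simp) ((eVariationOn.mono f (Set.Icc_subset_Icc ha hb)).trans hv)

lemma Wv_ctrl {f : ℝ → ℝ} (hv : eVariationOn f (Set.Icc (0:ℝ) 1) ≤ 2) {x y : ℝ} (hx : 0 ≤ x) (hxy : x ≤ y) (hy : y ≤ 1) : |f y - f x| ≤ Wv f y - Wv f x := by
  have h := eVariationOn.Icc_add_Icc f (s := Set.univ) hx hxy (Set.mem_univ x)
  simp only [Set.univ_inter] at h
  have e : Wv f y = Wv f x + (eVariationOn f (Set.Icc x y)).toReal := by
    unfold Wv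
    rw [← h, ENNReal.toReal_add (ev_ne hv le_rfl (hxy.trans hy)) (ev_ne hv hx hy)]
  rw [e, add_sub_cancel_left]
  have := eVariationOn.edist_le f (s := Set.Icc x y) (Set.right_mem_Icc.2 hxy) (Set.left_mem_Icc.2 hxy)
  rw [edist_dist, ENNReal.ofReal_le_iff_le_toReal (ev_ne hv hx hy), Real.dist_eq] at this
  exact this

lemma Wv_le {f : ℝ → ℝ} (hv : eVariationOn f (Set.Icc (0:ℝ) 1) ≤ 2) {x : ℝ} (hx : x ≤ 1) : Wv f x ≤ 2 := by
  have h := (eVariationOn.mono f (Set.Icc_subset_Icc (le_refl (0:ℝ)) hx)).trans hv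
  have := ENNReal.toReal_mono (by simp) h
  simpa [Wv] using this

lemma Wv_nonneg {f : ℝ → ℝ} (x : ℝ) : 0 ≤ Wv f x := ENNReal.toReal_nonneg

lemma f_fract {f : ℝ → ℝ} (hp : ∀ x : ℝ, f (x + 1) = f x) (x : ℝ) : f (Int.fract x) = f x := by
  have : Function.Periodic f 1 := hp
  have := this.sub_int_mul_eq (x := x) ⌊x⌋
  rw [mul_one] at this
  exact this

lemma Tf_ctrl {f : ℝ → ℝ} (hv : eVariationOn f (Set.Icc (0:ℝ) 1) ≤ 2) (hp : ∀ x : ℝ, f (x + 1) = f x) {x y : ℝ} (hxy : x ≤ y) : |f y - f x| ≤ Tf f y - Tf f x := by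
  rw [← f_fract hp x, ← f_fract hp y]
  have x0 := Int.fract_nonneg x
  have x1 := (Int.fract_lt_one x).le
  have y0 := Int.fract_nonneg y
  have y1 := (Int.fract_lt_one y).le
  have ef := Int.self_sub_floor x
  have eg := Int.self_sub_floor y
  unfold Tf
  rcases (Int.floor_mono hxy).eq_or_lt with h | h
  · rw [h] at ef ⊢
    have := Wv_ctrl hv x0 (show Int.fract x ≤ Int.fract y by linarith) y1
    linarith
  · have h1 : (⌊x⌋ : ℝ) + 1 ≤ ⌊y⌋ := by exact_mod_cast h
    have a1 := Wv_ctrl hv le_rfl y0 y1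
    have a2 := Wv_ctrl hv x0 x1 le_rfl
    have a3 := Wv_le hv (le_refl (1:ℝ))
    have a4 := Wv_nonneg (f := f) 0
    have e : f 1 = f 0 := by have := hp 0; rwa [zero_add] at this
    rw [e] at a2
    have := abs_sub_le (f (Int.fract y)) (f 0) (f (Int.fract x))
    linarith

lemma Tf_var {f : ℝ → ℝ} (hv : eVariationOn f (Set.Icc (0:ℝ) 1) ≤ 2) {x y : ℝ} (hxy : y ≤ x + 2) : Tf f y - Tf f x ≤ 6 := by
  have h1 : ⌊y⌋ ≤ ⌊x⌋ + 2 := by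
    have := Int.floor_mono hxy
    rwa [show x + 2 = x + ((2:ℤ):ℝ) by norm_num, Int.floor_add_intCast] at this
  have h2 : (⌊y⌋ : ℝ) ≤ ⌊x⌋ + 2 := by exact_mod_cast h1
  have := Wv_le hv (Int.fract_lt_one y).le
  have := Wv_nonneg (f := f) (Int.fract x)
  unfold Tf
  linarith

lemma f_meas {f : ℝ → ℝ} (hv : eVariationOn f (Set.Icc (0:ℝ) 1) ≤ 2) (hp : ∀ x : ℝ, f (x + 1) = f x) : Measurable f := by
  have h1 : Monotone (Tf f) := fun x y hxy => by
    have := (abs_nonneg _).trans (Tf_ctrl hv hp hxy); linarith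
  have h2 : Monotone (fun x => f x + Tf f x) := fun x y hxy => by
    have := (abs_le.1 (Tf_ctrl hv hp hxy)).1; show f x + Tf f x ≤ f y + Tf f y; linarith
  have := h2.measurable.sub h1.measurable
  have e : (fun x => f x + Tf f x) - Tf f = f := by ext x; simp
  rwa [e] at this

lemma f_bdd {f : ℝ → ℝ} (hv : eVariationOn f (Set.Icc (0:ℝ) 1) ≤ 2) (hp : ∀ x : ℝ, f (x + 1) = f x) (hm : ∫ x in (0:ℝ)..1, f x = 0) (x : ℝ) : |f x| ≤ 2 := by
  have hd : ∀ a b : ℝ, 0 ≤ a → a ≤ 1 → 0 ≤ b → b ≤ 1 → |f a - f b| ≤ 2 := fun a b a0 a1 b0 b1 => by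
    have := (eVariationOn.edist_le f (s := Set.Icc 0 1) (x := a) (y := b) ⟨a0, a1⟩ ⟨b0, b1⟩).trans hv
    rw [edist_dist, Real.dist_eq] at this
    exact (ENNReal.ofReal_le_ofReal_iff (by norm_num)).1 (by simpa using this)
  have fm := f_meas hv hp
  have ii : IntervalIntegrable f volume 0 1 := by
    refine bdd_intervalIntegrable (M := |f 0| + 2) zero_le_one fm (fun x h0 h1 => ?_)
    have := hd x 0 h0 h1 le_rfl zero_le_one
    have := abs_sub_abs_le_abs_sub (f x) (f 0)
    linarith
  rw [← f_fract hp x]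
  set y := Int.fract x
  have e : ∫ z in (0:ℝ)..1, (f y - f z) = f y := by
    rw [intervalIntegral.integral_sub (by simp) ii, hm]; simp
  rw [← e]
  have := abs_integral_le_const (F := fun z => f y - f z) (M := 2) zero_le_one (fun z h0 h1 => hd y z (Int.fract_nonneg x) (Int.fract_lt_one x).le h0 h1)
  linarith

lemma int_cos {c : ℝ} (hc : c ≠ 0) (x y : ℝ) : ∫ t in x..y, Real.cos (c * t) = (Real.sin (c * y) - Real.sin (c * x)) / c := by
  rw [intervalIntegral.integral_comp_mul_left (f := Real.cos) hc, integral_cos, smul_eq_mul]; field_simp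

lemma int_sin {c : ℝ} (hc : c ≠ 0) (x y : ℝ) : ∫ t in x..y, Real.sin (c * t) = (Real.cos (c * x) - Real.cos (c * y)) / c := by
  rw [intervalIntegral.integral_comp_mul_left (f := Real.sin) hc, integral_sin, smul_eq_mul]; field_simp

lemma abs_int_le {u v c : ℝ} {j : ℕ} (hj : 1 ≤ j) (hc : c = 2 * Real.pi * j) (hu : |u| ≤ 1) (hv : |v| ≤ 1) : |(u - v) / c| ≤ 1 / (3 * j) := by
  have j0 : (0:ℝ) < j := by exact_mod_cast hj
  have := Real.pi_gt_three
  have c6 : 6 * j ≤ c := by rw [hc]; nlinarith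
  have c0 : 0 < c := by linarith [mul_pos (show (0:ℝ) < 6 by norm_num) j0]
  rw [abs_div, abs_of_pos c0]
  have := abs_sub u v
  calc |u - v| / c ≤ 2 / (6 * j) := by
        gcongr; linarith
    _ = _ := by field_simp; norm_num

lemma coef_bd {f : ℝ → ℝ} (hp : ∀ x : ℝ, f (x + 1) = f x) (hm : ∫ x in (0:ℝ)..1, f x = 0)
    (hv : eVariationOn f (Set.Icc (0:ℝ) 1) ≤ 2) {j : ℕ} (hj : 1 ≤ j) :
    |∫ x in (0:ℝ)..1, f x * Real.cos (2 * Real.pi * j * x)| ≤ 3 / j ∧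
    |∫ x in (0:ℝ)..1, f x * Real.sin (2 * Real.pi * j * x)| ≤ 3 / j := by
  have j0 : (0:ℝ) < j := by exact_mod_cast hj
  have hc : 2 * Real.pi * j ≠ 0 := by positivity
  have fm := f_meas hv hp
  have f0 := f_bdd hv hp hm 0
  have T1 : Tf f 1 - Tf f 0 ≤ 6 := Tf_var hv (by norm_num)
  have fin : 1 / (3 * (j:ℝ)) * (|f 0| + (Tf f 1 - Tf f 0)) ≤ 3 / j := by
    calc _ ≤ 1 / (3 * (j:ℝ)) * (2 + 6) := by gcongr
      _ ≤ _ := by rw [div_mul_eq_mul_div, div_le_div_iff₀ (by positivity) j0]; nlinarith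
  constructor
  · refine le_trans (bv_ibp (T := Tf f) (ω := 1 / (3 * j)) (M := 1) zero_le_one fm (by fun_prop) (fun x y _ h _ => Tf_ctrl hv hp h) (fun x _ _ => Real.abs_cos_le_one _) (fun x y _ _ _ => ?_)) fin
    rw [int_cos hc]
    exact abs_int_le hj rfl (Real.abs_sin_le_one _) (Real.abs_sin_le_one _)
  · refine le_trans (bv_ibp (T := Tf f) (ω := 1 / (3 * j)) (M := 1) zero_le_one fm (by fun_prop) (fun x y _ h _ => Tf_ctrl hv hp h) (fun x _ _ => Real.abs_sin_le_one _) (fun x y _ _ _ => ?_)) fin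
    rw [int_sin hc]
    exact abs_int_le hj rfl (Real.abs_cos_le_one _) (Real.abs_cos_le_one _)

lemma I_cos (m : ℤ) (hm : m ≠ 0) : ∫ x in (0:ℝ)..1, Real.cos (2 * Real.pi * m * x) = 0 := by
  have : (2 * Real.pi * m : ℝ) ≠ 0 := by have : (m:ℝ) ≠ 0 := by exact_mod_cast hm
                                         have := Real.pi_ne_zero; positivity
  rw [int_cos this, mul_one, mul_zero, show 2 * Real.pi * m = m * (2 * Real.pi) by ring]
  have h := Real.sin_int_mul_pi (2 * m)
  push_cast at h
  rw [show (m:ℝ) * (2 * Real.pi) = 2 * m * Real.pi by ring, h]; simp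

lemma I_sin (m : ℤ) : ∫ x in (0:ℝ)..1, Real.sin (2 * Real.pi * m * x) = 0 := by
  by_cases hm : m = 0
  · simp [hm]
  have : (2 * Real.pi * m : ℝ) ≠ 0 := by have : (m:ℝ) ≠ 0 := by exact_mod_cast hm
                                         have := Real.pi_ne_zero; positivity
  rw [int_sin this, mul_one, mul_zero, show 2 * Real.pi * m = m * (2 * Real.pi) by ring, Real.cos_int_mul_two_pi]; simp

lemma I_cc (j n : ℕ) (hj : 1 ≤ j) : ∫ x in (0:ℝ)..1, Real.cos (2 * Real.pi * j * x) * Real.cos (2 * Real.pi * n * x) = if j = n then 1 / 2 else 0 := by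
  have e : ∀ x : ℝ, Real.cos (2 * Real.pi * j * x) * Real.cos (2 * Real.pi * n * x) =
      1 / 2 * Real.cos (2 * Real.pi * ((j - n : ℤ) : ℝ) * x) + 1 / 2 * Real.cos (2 * Real.pi * ((j + n : ℤ) : ℝ) * x) := fun x => by
    push_cast
    rw [show 2 * Real.pi * ((j:ℝ) - n) * x = 2 * Real.pi * j * x - 2 * Real.pi * n * x by ring,
      show 2 * Real.pi * ((j:ℝ) + n) * x = 2 * Real.pi * j * x + 2 * Real.pi * n * x by ring, Real.cos_sub, Real.cos_add]; ring
  simp_rw [e]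
  rw [intervalIntegral.integral_add (Continuous.intervalIntegrable (by fun_prop) _ _) (Continuous.intervalIntegrable (by fun_prop) _ _),
    intervalIntegral.integral_const_mul, intervalIntegral.integral_const_mul, I_cos (j + n) (by omega)]
  split_ifs with h
  · simp [h]
  · rw [I_cos _ (by omega)]; simp

lemma I_ss (j n : ℕ) (hj : 1 ≤ j) : ∫ x in (0:ℝ)..1, Real.sin (2 * Real.pi * j * x) * Real.sin (2 * Real.pi * n * x) = if j = n then 1 / 2 else 0 := by
  have e : ∀ x : ℝ, Real.sin (2 * Real.pi * j * x) * Real.sin (2 * Real.pi * n * x) =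
      1 / 2 * Real.cos (2 * Real.pi * ((j - n : ℤ) : ℝ) * x) - 1 / 2 * Real.cos (2 * Real.pi * ((j + n : ℤ) : ℝ) * x) := fun x => by
    push_cast
    rw [show 2 * Real.pi * ((j:ℝ) - n) * x = 2 * Real.pi * j * x - 2 * Real.pi * n * x by ring,
      show 2 * Real.pi * ((j:ℝ) + n) * x = 2 * Real.pi * j * x + 2 * Real.pi * n * x by ring, Real.cos_sub, Real.cos_add]; ring
  simp_rw [e]
  rw [intervalIntegral.integral_sub (Continuous.intervalIntegrable (by fun_prop) _ _) (Continuous.intervalIntegrable (by fun_prop) _ _),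
    intervalIntegral.integral_const_mul, intervalIntegral.integral_const_mul, I_cos (j + n) (by omega)]
  split_ifs with h
  · simp [h]
  · rw [I_cos _ (by omega)]; simp

lemma I_sc (j n : ℕ) : ∫ x in (0:ℝ)..1, Real.sin (2 * Real.pi * j * x) * Real.cos (2 * Real.pi * n * x) = 0 := by
  have e : ∀ x : ℝ, Real.sin (2 * Real.pi * j * x) * Real.cos (2 * Real.pi * n * x) =
      1 / 2 * Real.sin (2 * Real.pi * ((j - n : ℤ) : ℝ) * x) + 1 / 2 * Real.sin (2 * Real.pi * ((j + n : ℤ) : ℝ) * x) := fun x => by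
    push_cast
    rw [show 2 * Real.pi * ((j:ℝ) - n) * x = 2 * Real.pi * j * x - 2 * Real.pi * n * x by ring,
      show 2 * Real.pi * ((j:ℝ) + n) * x = 2 * Real.pi * j * x + 2 * Real.pi * n * x by ring, Real.sin_sub, Real.sin_add]; ring
  simp_rw [e]
  rw [intervalIntegral.integral_add (Continuous.intervalIntegrable (by fun_prop) _ _) (Continuous.intervalIntegrable (by fun_prop) _ _),
    intervalIntegral.integral_const_mul, intervalIntegral.integral_const_mul, I_sin, I_sin]; simp

lemma part_cont (f : ℝ → ℝ) (d : ℕ) : Continuous (fourierPartial f d) := by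
  unfold fourierPartial; fun_prop

lemma part_cos (f : ℝ → ℝ) (d n : ℕ) : ∫ x in (0:ℝ)..1, fourierPartial f d x * Real.cos (2 * Real.pi * n * x) =
    if n ∈ Finset.Icc 1 d then fourierA f n / 2 else 0 := by
  unfold fourierPartial
  simp_rw [Finset.sum_mul]
  rw [intervalIntegral.integral_finsetSum (fun j _ => Continuous.intervalIntegrable (by fun_prop) _ _)]
  have : ∀ j ∈ Finset.Icc 1 d, ∫ x in (0:ℝ)..1, (fourierA f j * Real.cos (2 * Real.pi * j * x) +
     fourierB f j * Real.sin (2 * Real.pi * j * x)) * Real.cos (2 * Real.pi * n * x) = if j = n then fourierA f n / 2 else 0 := by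
    intro j hj
    simp_rw [add_mul, mul_assoc (fourierA f j), mul_assoc (fourierB f j)]
    rw [intervalIntegral.integral_add (Continuous.intervalIntegrable (by fun_prop) _ _) (Continuous.intervalIntegrable (by fun_prop) _ _),
      intervalIntegral.integral_const_mul, intervalIntegral.integral_const_mul, I_sc, I_cc j n (Finset.mem_Icc.1 hj).1]
    split_ifs with h
    · rw [h]; ring
    · simp
  rw [Finset.sum_congr rfl this, Finset.sum_ite_eq']

lemma part_sin (f : ℝ → ℝ) (d n : ℕ) : ∫ x in (0:ℝ)..1, fourierPartial f d x * Real.sin (2 * Real.pi * n * x) =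
    if n ∈ Finset.Icc 1 d then fourierB f n / 2 else 0 := by
  unfold fourierPartial
  simp_rw [Finset.sum_mul]
  rw [intervalIntegral.integral_finsetSum (fun j _ => Continuous.intervalIntegrable (by fun_prop) _ _)]
  have : ∀ j ∈ Finset.Icc 1 d, ∫ x in (0:ℝ)..1, (fourierA f j * Real.cos (2 * Real.pi * j * x) +
     fourierB f j * Real.sin (2 * Real.pi * j * x)) * Real.sin (2 * Real.pi * n * x) = if j = n then fourierB f n / 2 else 0 := by
    intro j hj
    simp_rw [add_mul, mul_assoc (fourierA f j), mul_assoc (fourierB f j), mul_comm (Real.cos (2 * Real.pi * j * _))]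
    rw [intervalIntegral.integral_add (Continuous.intervalIntegrable (by fun_prop) _ _) (Continuous.intervalIntegrable (by fun_prop) _ _),
      intervalIntegral.integral_const_mul, intervalIntegral.integral_const_mul, I_sc, I_ss j n (Finset.mem_Icc.1 hj).1]
    split_ifs with h
    · rw [h]; ring
    · simp
  rw [Finset.sum_congr rfl this, Finset.sum_ite_eq']


noncomputable def Cc (g : ℝ → ℝ) (n : ℤ) : ℝ := ∫ x in (0:ℝ)..1, g x * Real.cos (2 * Real.pi * n * x)
noncomputable def Ss (g : ℝ → ℝ) (n : ℤ) : ℝ := ∫ x in (0:ℝ)..1, g x * Real.sin (2 * Real.pi * n * x)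

lemma ii_mul {g k : ℝ → ℝ} {M : ℝ} (hg : Measurable g) (hM : ∀ x, |g x| ≤ M) (hk : Measurable k) (hk1 : ∀ x, |k x| ≤ 1) :
    IntervalIntegrable (fun x => g x * k x) volume 0 1 := by
  refine bdd_intervalIntegrable (M := M) zero_le_one (hg.mul hk) (fun x _ _ => ?_)
  show |g x * k x| ≤ M
  rw [abs_mul]
  have := hM x
  have := hk1 x
  have := abs_nonneg (g x)
  have := abs_nonneg (k x)
  nlinarith

lemma coeff_norm {g : ℝ → ℝ} {M : ℝ} (hg : Measurable g) (hM : ∀ x, |g x| ≤ M) (n : ℤ) :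
    ‖fourierCoeffOn (zero_lt_one (α := ℝ)) (fun x => (g x : ℂ)) n‖ ^ 2 = Cc g n ^ 2 + Ss g n ^ 2 := by
  rw [fourierCoeffOn_eq_integral]
  have i1 := ii_mul (k := fun x => Real.cos (2 * Real.pi * n * x)) hg hM (by fun_prop) (fun x => Real.abs_cos_le_one _)
  have i2 := ii_mul (k := fun x => Real.sin (2 * Real.pi * n * x)) hg hM (by fun_prop) (fun x => Real.abs_sin_le_one _)
  have e : ∀ x : ℝ, (fourier (-n) (x : AddCircle ((1:ℝ) - 0)) • (g x : ℂ)) =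
      ((g x * Real.cos (2 * Real.pi * n * x) : ℝ) : ℂ) - ((g x * Real.sin (2 * Real.pi * n * x) : ℝ) : ℂ) * Complex.I := fun x => by
    rw [fourier_coe_apply, smul_eq_mul]
    have : 2 * (Real.pi : ℂ) * Complex.I * ((-n : ℤ) : ℂ) * (x : ℂ) / (((1:ℝ) - 0 : ℝ) : ℂ) = ((-(2 * Real.pi * n * x) : ℝ) : ℂ) * Complex.I := by
      push_cast; ring
    rw [this, Complex.exp_mul_I, ← Complex.ofReal_cos, ← Complex.ofReal_sin, Real.cos_neg, Real.sin_neg]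
    push_cast; ring
  simp_rw [e]
  rw [intervalIntegral.integral_sub, intervalIntegral.integral_mul_const, intervalIntegral.integral_ofReal, intervalIntegral.integral_ofReal]
  · change ‖((1 / ((1:ℝ) - 0)) : ℝ) • (((Cc g n : ℝ) : ℂ) - ((Ss g n : ℝ) : ℂ) * Complex.I)‖ ^ 2 = _
    rw [sub_zero, div_one, one_smul, ← Complex.normSq_eq_norm_sq, Complex.normSq_apply]
    simp
    ring
  · exact ⟨i1.1.ofReal, i1.2.ofReal⟩
  · exact ⟨i2.1.ofReal.mul_const _, i2.2.ofReal.mul_const _⟩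

lemma parseval {g : ℝ → ℝ} {M : ℝ} (hg : Measurable g) (hM : ∀ x, |g x| ≤ M) :
    HasSum (fun n : ℤ => Cc g n ^ 2 + Ss g n ^ 2) (∫ x in (0:ℝ)..1, g x ^ 2) := by
  have hL : MemLp (fun x => (g x : ℂ)) 2 (volume.restrict (Set.Ioc (0:ℝ) 1)) := by
    refine MemLp.of_bound (C := M) (Complex.measurable_ofReal.comp hg).aestronglyMeasurable (Eventually.of_forall fun x => ?_)
    rw [Complex.norm_real]; exact hM x
  have := hasSum_sq_fourierCoeffOn (zero_lt_one (α := ℝ)) hL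
  simp_rw [coeff_norm hg hM] at this
  simpa using this

lemma parseval_nat {g : ℝ → ℝ} {M : ℝ} (hg : Measurable g) (hM : ∀ x, |g x| ≤ M) (h0 : ∫ x in (0:ℝ)..1, g x = 0) :
    HasSum (fun n : ℕ => 2 * (Cc g n ^ 2 + Ss g n ^ 2)) (∫ x in (0:ℝ)..1, g x ^ 2) := by
  have h := (parseval hg hM).nat_add_neg
  have c0 : Cc g 0 = 0 := by simp [Cc, h0]
  have s0 : Ss g 0 = 0 := by simp [Ss]
  have c1 : ∀ n : ℤ, Cc g (-n) = Cc g n := fun n => by simp [Cc]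
  have s1 : ∀ n : ℤ, Ss g (-n) = - Ss g n := fun n => by simp [Ss]
  simp only [c0, s0, c1, s1] at h
  convert h using 1
  · ext n; ring
  · ring

lemma sum_tail_le {e : ℕ → ℝ} {I K : ℝ} {d : ℕ} (hd : 1 ≤ d) (h : HasSum e I) (h0 : ∀ n, n ≤ d → e n = 0)
    (h1 : ∀ n, d < n → e n ≤ K / (n:ℝ) ^ 2) (hK : 0 ≤ K) : I ≤ K / d := by
  have d0 : (0:ℝ) < d := by exact_mod_cast hd
  have key : ∀ m : ℕ, ∑ n ∈ Finset.range (d + 1 + m), e n ≤ K * (1 / d - 1 / (d + m : ℕ)) := by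
    intro m
    induction m with
    | zero =>
      rw [Finset.sum_eq_zero (fun n hn => h0 n (by have := Finset.mem_range.1 hn; omega))]
      simp
    | succ m ih =>
      rw [← add_assoc, Finset.sum_range_succ]
      have a := h1 (d + 1 + m) (by omega)
      have q : (0:ℝ) < (d + m : ℕ) := by push_cast; positivity
      have b : K / ((d + 1 + m : ℕ) : ℝ) ^ 2 ≤ K * (1 / (d + m : ℕ) - 1 / (d + (m + 1) : ℕ)) := by
        rw [div_eq_mul_one_div]
        gcongr
        have e1 : ((d + 1 + m : ℕ) : ℝ) = (d + m : ℕ) + 1 := by push_cast; ring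
        have e2 : ((d + (m + 1) : ℕ) : ℝ) = (d + m : ℕ) + 1 := by push_cast; ring
        rw [e1, e2]
        generalize ((d + m : ℕ) : ℝ) = y at q ⊢
        rw [div_sub_div _ _ (by positivity) (by positivity), div_le_div_iff₀ (by positivity) (by positivity)]
        nlinarith
      linarith
  have t := h.tendsto_sum_nat.comp (tendsto_add_atTop_nat (d + 1))
  refine le_of_tendsto' t (fun m => ?_)
  have := key m
  simp only [Function.comp]
  rw [add_comm m]
  refine this.trans ?_
  have : (0:ℝ) ≤ 1 / (d + m : ℕ) := by positivity
  rw [div_eq_mul_one_div K]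
  exact mul_le_mul_of_nonneg_left (by linarith) hK

lemma part_AB {f : ℝ → ℝ} (hp : ∀ x : ℝ, f (x + 1) = f x) (hm : ∫ x in (0:ℝ)..1, f x = 0)
    (hv : eVariationOn f (Set.Icc (0:ℝ) 1) ≤ 2) {j : ℕ} (hj : 1 ≤ j) :
    |fourierA f j| ≤ 6 / j ∧ |fourierB f j| ≤ 6 / j := by
  obtain ⟨h1, h2⟩ := coef_bd hp hm hv hj
  unfold fourierA fourierB
  rw [abs_mul, abs_mul, abs_two, show (6:ℝ) / j = 2 * (3 / j) by ring]
  constructor <;> gcongr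

lemma part_bdd {f : ℝ → ℝ} (hp : ∀ x : ℝ, f (x + 1) = f x) (hm : ∫ x in (0:ℝ)..1, f x = 0)
    (hv : eVariationOn f (Set.Icc (0:ℝ) 1) ≤ 2) (d : ℕ) (x : ℝ) : |fourierPartial f d x| ≤ 12 * d := by
  unfold fourierPartial
  refine (Finset.abs_sum_le_sum_abs _ _).trans ?_
  refine (Finset.sum_le_card_nsmul _ _ 12 (fun j hj => ?_)).trans (le_of_eq ?_)
  · have hj := (Finset.mem_Icc.1 hj).1
    obtain ⟨h1, h2⟩ := part_AB hp hm hv hj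
    have j1 : (1:ℝ) ≤ j := by exact_mod_cast hj
    have : (6:ℝ) / j ≤ 6 := div_le_self (by norm_num) j1
    refine (abs_add_le _ _).trans ?_
    rw [abs_mul, abs_mul]
    have c := Real.abs_cos_le_one (2 * Real.pi * j * x)
    have s := Real.abs_sin_le_one (2 * Real.pi * j * x)
    have := mul_le_mul (h1.trans this) c (abs_nonneg _) (by norm_num)
    have := mul_le_mul (h2.trans ‹(6:ℝ) / j ≤ 6›) s (abs_nonneg _) (by norm_num)
    linarith
  · rw [Nat.card_Icc, nsmul_eq_mul]; simp; ring

lemma abs_cos_sub_le (x y : ℝ) : |Real.cos x - Real.cos y| ≤ |x - y| := by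
  have := Real.lipschitzWith_cos.dist_le_mul x y
  simpa [Real.dist_eq] using this
lemma abs_sin_sub_le (x y : ℝ) : |Real.sin x - Real.sin y| ≤ |x - y| := by
  have := Real.lipschitzWith_sin.dist_le_mul x y
  simpa [Real.dist_eq] using this

lemma part_lip {f : ℝ → ℝ} (hp : ∀ x : ℝ, f (x + 1) = f x) (hm : ∫ x in (0:ℝ)..1, f x = 0)
    (hv : eVariationOn f (Set.Icc (0:ℝ) 1) ≤ 2) (d : ℕ) {x y : ℝ} (hxy : x ≤ y) :
    |fourierPartial f d y - fourierPartial f d x| ≤ 80 * d * (y - x) := by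
  unfold fourierPartial
  rw [← Finset.sum_sub_distrib]
  refine (Finset.abs_sum_le_sum_abs _ _).trans ?_
  refine (Finset.sum_le_card_nsmul _ _ (80 * (y - x)) (fun j hj => ?_)).trans (le_of_eq ?_)
  · have hj := (Finset.mem_Icc.1 hj).1
    obtain ⟨h1, h2⟩ := part_AB hp hm hv hj
    have j0 : (0:ℝ) < j := by exact_mod_cast hj
    have yx : 0 ≤ y - x := by linarith
    have e : |2 * Real.pi * j * y - 2 * Real.pi * j * x| = 2 * Real.pi * j * (y - x) := by
      rw [← mul_sub, abs_of_nonneg (by have := Real.pi_pos; positivity)]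
    have c := abs_cos_sub_le (2 * Real.pi * j * y) (2 * Real.pi * j * x)
    have s := abs_sin_sub_le (2 * Real.pi * j * y) (2 * Real.pi * j * x)
    rw [e] at c s
    have m1 := mul_le_mul h1 c (abs_nonneg _) (by positivity)
    have m2 := mul_le_mul h2 s (abs_nonneg _) (by positivity)
    have e2 : 6 / (j:ℝ) * (2 * Real.pi * j * (y - x)) = 12 * Real.pi * (y - x) := by field_simp; ring
    rw [e2, ← abs_mul] at m1 m2
    have pi := Real.pi_lt_d2
    have := mul_le_mul_of_nonneg_right pi.le yx
    have := abs_add_le (fourierA f j * (Real.cos (2 * Real.pi * j * y) - Real.cos (2 * Real.pi * j * x)))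
      (fourierB f j * (Real.sin (2 * Real.pi * j * y) - Real.sin (2 * Real.pi * j * x)))
    rw [show fourierA f j * Real.cos (2 * Real.pi * j * y) + fourierB f j * Real.sin (2 * Real.pi * j * y) -
      (fourierA f j * Real.cos (2 * Real.pi * j * x) + fourierB f j * Real.sin (2 * Real.pi * j * x)) =
      fourierA f j * (Real.cos (2 * Real.pi * j * y) - Real.cos (2 * Real.pi * j * x)) +
      fourierB f j * (Real.sin (2 * Real.pi * j * y) - Real.sin (2 * Real.pi * j * x)) by ring]
    norm_num at pi
    linarith
  · rw [Nat.card_Icc, nsmul_eq_mul]; simp; ring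

lemma part_per (f : ℝ → ℝ) (d : ℕ) (x : ℝ) : fourierPartial f d (x + 1) = fourierPartial f d x := by
  unfold fourierPartial
  refine Finset.sum_congr rfl (fun j _ => ?_)
  rw [show 2 * Real.pi * j * (x + 1) = 2 * Real.pi * j * x + j * (2 * Real.pi) by ring,
    Real.cos_add_nat_mul_two_pi, Real.sin_add_nat_mul_two_pi]

lemma rh_inst {f : ℝ → ℝ} (hp : ∀ x : ℝ, f (x + 1) = f x) (hm : ∫ x in (0:ℝ)..1, f x = 0)
    (hv : eVariationOn f (Set.Icc (0:ℝ) 1) ≤ 2) {d : ℕ} (hd : 1 ≤ d) :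
    Rh (fun x => f x - fourierPartial f d x) (fun x => Tf f x + 80 * d * x) (6 + 160 * d) (2 + 12 * d) (36 / d) := by
  have fm := f_meas hv hp
  have fb := f_bdd hv hp hm
  have pm := (part_cont f d).measurable
  have pb := part_bdd hp hm hv d
  have rm : Measurable (fun x => f x - fourierPartial f d x) := fm.sub pm
  have rb : ∀ x, |f x - fourierPartial f d x| ≤ 2 + 12 * d := fun x =>
    (abs_sub _ _).trans (add_le_add (fb x) (pb x))
  have cC : ∀ n : ℕ, Cc (fun x => f x - fourierPartial f d x) n = if n ∈ Finset.Icc 1 d then 0 else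
      ∫ x in (0:ℝ)..1, f x * Real.cos (2 * Real.pi * n * x) := fun n => by
    unfold Cc
    simp_rw [sub_mul, Int.cast_natCast]
    rw [intervalIntegral.integral_sub (ii_mul fm fb (by fun_prop) (fun x => Real.abs_cos_le_one _))
      (ii_mul pm pb (by fun_prop) (fun x => Real.abs_cos_le_one _)), part_cos]
    split_ifs with h
    · unfold fourierA; ring
    · ring
  have cS : ∀ n : ℕ, Ss (fun x => f x - fourierPartial f d x) n = if n ∈ Finset.Icc 1 d then 0 else
      ∫ x in (0:ℝ)..1, f x * Real.sin (2 * Real.pi * n * x) := fun n => by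
    unfold Ss
    simp_rw [sub_mul, Int.cast_natCast]
    rw [intervalIntegral.integral_sub (ii_mul fm fb (by fun_prop) (fun x => Real.abs_sin_le_one _))
      (ii_mul pm pb (by fun_prop) (fun x => Real.abs_sin_le_one _)), part_sin]
    split_ifs with h
    · unfold fourierB; ring
    · ring
  have mean : ∫ x in (0:ℝ)..1, (f x - fourierPartial f d x) = 0 := by
    have := cC 0
    simpa [Cc, hm] using this
  refine ⟨rm, ?_, mean, ?_, ?_, rb, ?_⟩
  · intro x
    show f (x + 1) - fourierPartial f d (x + 1) = _
    rw [hp, part_per]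
  · intro x y hxy
    have h1 := Tf_ctrl hv hp hxy
    have h2 := part_lip hp hm hv d hxy
    have := abs_sub (f y - f x) (fourierPartial f d y - fourierPartial f d x)
    rw [show f y - fourierPartial f d y - (f x - fourierPartial f d x) = f y - f x - (fourierPartial f d y - fourierPartial f d x) by ring]
    linarith
  · intro x y hxy h2
    have h1 := Tf_var hv h2
    have d0 : (0:ℝ) ≤ d := by positivity
    show Tf f y + 80 * d * y - (Tf f x + 80 * d * x) ≤ 6 + 160 * d
    nlinarith
  · refine sum_tail_le hd (parseval_nat rm rb mean) ?_ ?_ (by norm_num)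
    · intro n hn
      rw [cC, cS]
      rcases Nat.eq_zero_or_pos n with h | h
      · simp [h, hm]
      · rw [if_pos (Finset.mem_Icc.2 ⟨h, hn⟩), if_pos (Finset.mem_Icc.2 ⟨h, hn⟩)]; ring
    · intro n hn
      have nm : n ∉ Finset.Icc 1 d := by rw [Finset.mem_Icc]; omega
      rw [cC, cS, if_neg nm, if_neg nm]
      obtain ⟨h1, h2⟩ := coef_bd hp hm hv (j := n) (by omega)
      have h1 := pow_le_pow_left₀ (abs_nonneg _) h1 2
      have h2 := pow_le_pow_left₀ (abs_nonneg _) h2 2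
      rw [sq_abs] at h1 h2
      rw [show (36:ℝ) / (n:ℝ) ^ 2 = 4 * (3 / (n:ℝ)) ^ 2 by rw [div_pow]; ring]
      linarith

theorem stmt12 (ξ A B : ℝ) (hξ : 0 < ξ) (hA : 1 < A) (hAB : B - A = 1) :
    ∃ c : ℝ, 1 ≤ c ∧
      ∀ s : ℕ → ℕ, StrictMono s → (∀ n, 1 ≤ n → 1 ≤ s n) →
      ∀ f : ℝ → ℝ, (∀ x : ℝ, f (x + 1) = f x) → (∫ x in (0:ℝ)..1, f x) = 0 →
        eVariationOn f (Set.Icc (0:ℝ) 1) ≤ 2 →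
      ∀ d : ℕ, 1 ≤ d →
        ∀ᵐ x : ℝ ∂volume, x ∈ Set.Icc A B →
          Filter.atTop.limsup (fun N : ℕ =>
              |∑ n ∈ Finset.Icc 1 N,
                  (f (ξ * x ^ s n) - fourierPartial f d (ξ * x ^ s n))| /
                Real.sqrt (N * plog (plog N))) ≤
            238 * c * (d : ℝ) ^ (-(1/8) : ℝ) := by
  have q1 : √A⁻¹ < 1 := by
    rw [Real.sqrt_lt' one_pos, one_pow]; exact inv_lt_one_of_one_lt₀ hA
  have q2 : 0 < 1 - √A⁻¹ := by linarith
  obtain ⟨κ, hκ⟩ : ∃ κ, κ = √(2400 / (1 - √A⁻¹)) := ⟨_, rfl⟩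
  have κ0 : 0 < κ := by rw [hκ]; positivity
  have κ2 : κ ^ 2 = 2400 / (1 - √A⁻¹) := by rw [hκ, Real.sq_sqrt (by positivity)]
  refine ⟨1 + 3 * κ, by linarith, ?_⟩
  intro s hs _ f hp hm hv d hd
  have d1 : (1:ℝ) ≤ d := by exact_mod_cast hd
  have d0 : (0:ℝ) < d := by linarith
  obtain ⟨p0, h⟩ := ph_inst hξ hA hAB hs
  have hr := rh_inst hp hm hv hd
  obtain ⟨e, he⟩ : ∃ e : ℝ, e = (d:ℝ) ^ (-(1/8) : ℝ) := ⟨_, rfl⟩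
  have e0 : 0 < e := by rw [he]; positivity
  have e4 : e ^ 4 = (√d)⁻¹ := by
    rw [he, ← Real.rpow_natCast, ← Real.rpow_mul d0.le, Real.sqrt_eq_rpow, ← Real.rpow_neg d0.le]; norm_num
  have s0 : 0 < √(d:ℝ) := Real.sqrt_pos.2 d0
  have ss : √(d:ℝ) ^ 2 = d := Real.sq_sqrt d0.le
  have hσ : 36 * (36 / (d:ℝ)) * √(36 / (d:ℝ)) * ((2 + 12 * d) + (6 + 160 * d)) ≤ (1200 * e ^ 2) ^ 2 := by
    rw [show (1200 * e ^ 2) ^ 2 = 1440000 * e ^ 4 by ring, e4, Real.sqrt_div (by norm_num),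
      show √(36:ℝ) = 6 by rw [show (36:ℝ) = 6 ^ 2 by norm_num]; exact Real.sqrt_sq (by norm_num)]
    calc _ ≤ 36 * (36 / (d:ℝ)) * (6 / √d) * (180 * d) := by gcongr; linarith
      _ = 1399680 * (√(d:ℝ))⁻¹ := by field_simp; norm_num
      _ ≤ _ := by gcongr; norm_num
  have fl := final_limsup h hAB hr (σ := 1200 * e ^ 2) (s := κ * e) (by positivity) hσ (by positivity)
    (by rw [mul_pow, κ2]; field_simp; norm_num)
  filter_upwards [fl] with x hx hxAB
  have hx := hx hxAB
  rw [← he]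
  refine limsup_le_of_le ?_ ?_
  · refine isCoboundedUnder_le_of_le atTop (x := 0) (fun N => by positivity)
  · filter_upwards [hx] with N hN
    refine le_trans hN ?_
    have := mul_pos κ0 e0
    nlinarith
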